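/- arXiv:1601.01067 — 3 statements merged into one kernel-verified Lean document; each statement's English description precedes it below -/
import Mathlib

section
/- Let F ∈ ℤ[x]^{n×m} be a matrix of full row rank n (over ℚ(x)) and b ∈ ℤ[x]^n a column vector; let d = max(deg(F), deg(b)) ≥ 1 and h = max(height(F), height(b)). If the system F·y = b has a solution y ∈ ℤ[x]^m, then it has such a solution of degree at most 3n²d²(2h₂ + log(nd+1)) + nd, where h₂ = 2(n(n+1)d + n)(h + log(n(n+1)d + n) + 1). -/
open Polynomial

/-- The height of an integer polynomial: the natural logarithm of the maximum of the
absolute values of its coefficients (the height of 0 is 0, since `Real.log 0 = 0`). -/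
noncomputable def polyHeight (f : Polynomial ℤ) : ℝ :=
  Real.log (((Finset.range (f.natDegree + 1)).sup fun k => (f.coeff k).natAbs : ℕ) : ℝ)


lemma coreA {R : Type*} [CommRing R] {n m s e : ℕ} (π : R) (G : Matrix (Fin n) (Fin m) R[X])
    (σ : Fin n → Fin m) (f w g w1 : R[X])
    (hG : ∀ i i', G i (σ i') = if i = i' then f else 0)
    (hdeg : ∀ i j, (G i j).natDegree ≤ s) (hf : f = w * g) (hg : g.Monic)
    (hw : w.natDegree + g.natDegree ≤ s) (hw1 : w = 1 + C π * w1)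
    (y l k0 : Fin m → R[X]) (hk0 : ∀ j, k0 j = y j + C π * l j)
    (hy : ∀ j, (y j).natDegree ≤ e) (h0 : G.mulVec k0 = 0) :
    ∃ k : Fin m → R[X], G.mulVec k = 0 ∧ (∀ j, (k j).natDegree ≤ e + 2 * s) ∧
      ∀ j, C π ∣ k j - y j := by
  classical
  let E : Matrix (Fin m) (Fin n) R[X] := fun j i => if σ i = j then 1 else 0
  have hGE : G * E = f • 1 := by
    ext1 i i'
    rw [Matrix.mul_apply]
    simp [E, hG, Matrix.one_apply]
  let a : Fin m → R[X] := fun j => l j /ₘ g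
  let b : Fin m → R[X] := fun j => l j %ₘ g
  have hab : ∀ j, b j + g * a j = l j := fun j => modByMonic_add_div _ _
  let μ : Fin m → R[X] := w • k0 - C π • (f • a - E.mulVec (G.mulVec a))
  have hGμ : G.mulVec μ = 0 := by
    simp only [μ, Matrix.mulVec_sub, Matrix.mulVec_smul, h0, Matrix.mulVec_mulVec]
    rw [← Matrix.mul_assoc, hGE, Matrix.smul_mul, Matrix.one_mul, Matrix.smul_mulVec]
    simp
  have hE : ∀ (v : Fin n → R[X]) j, j ∉ Set.range σ → E.mulVec v j = 0 := by
    intro v j hj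
    simp only [Matrix.mulVec, dotProduct, E]
    refine Finset.sum_eq_zero fun i _ => ?_
    rw [if_neg (fun h => hj ⟨i, h⟩), zero_mul]
  have hμ : ∀ j, j ∉ Set.range σ → μ j = w * (y j + C π * b j) := by
    intro j hj
    simp only [μ, Pi.sub_apply, Pi.smul_apply, hE _ j hj, smul_eq_mul, hk0, ← hab j, hf]
    ring
  have hνdeg : ∀ j, (w * (y j + C π * b j)).natDegree ≤ e + s := by
    intro j
    have h1 : (b j).natDegree ≤ g.natDegree := natDegree_modByMonic_le _ hg
    have h2 : (C π * b j).natDegree ≤ (b j).natDegree := natDegree_C_mul_le _ _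
    have h3 := natDegree_add_le (y j) (C π * b j)
    have h4 : (w * (y j + C π * b j)).natDegree ≤ _ := natDegree_mul_le
    have := hy j
    have h5 : max (y j).natDegree (C π * b j).natDegree ≤ e + g.natDegree := by
      apply max_le <;> omega
    omega
  refine ⟨w • μ, by rw [Matrix.mulVec_smul, hGμ, smul_zero], ?_, ?_⟩
  · intro j
    simp only [Pi.smul_apply, smul_eq_mul]
    by_cases hj : j ∈ Set.range σ
    · obtain ⟨i, rfl⟩ := hj
      have h1 := congrFun hGμ i
      simp only [Matrix.mulVec, dotProduct, Pi.zero_apply] at h1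
      rw [← Finset.add_sum_erase _ _ (Finset.mem_univ (σ i)), hG, if_pos rfl] at h1
      set ρ := ∑ x ∈ Finset.univ.erase (σ i), G i x * μ x with hρ
      have h2 : w * μ (σ i) = (-ρ) /ₘ g := by
        rw [← mul_divByMonic_cancel_left (w * μ (σ i)) hg]
        congr 1
        rw [hf] at h1
        linear_combination h1
      rw [h2, natDegree_divByMonic _ hg, natDegree_neg]
      refine (Nat.sub_le _ _).trans ?_
      refine natDegree_sum_le_of_forall_le _ _ fun x hx => ?_
      by_cases hxr : x ∈ Set.range σ
      · obtain ⟨i', rfl⟩ := hxr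
        rw [hG, if_neg]
        · simp
        · rintro rfl
          simp at hx
      · rw [hμ x hxr]
        have h4 : (G i x * (w * (y x + C π * b x))).natDegree ≤ _ := natDegree_mul_le
        have := hνdeg x
        have := hdeg i x
        omega
    · rw [hμ j hj]
      have h4 : (w * (w * (y j + C π * b j))).natDegree ≤ _ := natDegree_mul_le
      have := hνdeg j
      omega
  · intro j
    simp only [μ, Pi.sub_apply, Pi.smul_apply, smul_eq_mul, hk0]
    set z := f * a j - E.mulVec (G.mulVec a) j
    refine ⟨(2 * w1 + C π * w1 ^ 2) * y j + w * w * l j - w * z, ?_⟩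
    rw [hw1]
    ring

lemma hensel (p : ℤ) (hp : p ≠ 0) (s : ℕ) (f f0 f1 : ℤ[X]) (hf : f = f0 + C p * f1) (hf0 : f0.Monic)
    (h0 : f0.natDegree ≤ s) (h1 : f1.natDegree ≤ s) (k : ℕ) :
    ∃ w g h w1 : ℤ[X], f = w * g + C (p ^ (k + 1)) * h ∧ g.Monic ∧ g.natDegree = f0.natDegree ∧
      w = 1 + C p * w1 ∧ w.natDegree + g.natDegree ≤ s ∧ h.natDegree ≤ s := by
  induction k with
  | zero => exact ⟨1, f0, f1, 0, by rw [hf]; ring_nf, hf0, rfl, by simp, by simpa using h0, h1⟩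
  | succ k ih =>
    obtain ⟨w, g, h, w1, e1, hg, hgd, hw, hwd, hh⟩ := ih
    set a := h /ₘ g with ha
    set b := h %ₘ g with hb
    have hab : b + g * a = h := modByMonic_add_div _ _
    have had : a.natDegree + g.natDegree ≤ s := by
      rw [ha, natDegree_divByMonic _ hg]; omega
    have hbd : b.degree < g.degree := degree_modByMonic_lt _ hg
    have hbn : b.natDegree ≤ g.natDegree := natDegree_modByMonic_le _ hg
    have hbd' : (C (p ^ (k + 1)) * b).degree < g.degree :=
      by
      refine lt_of_le_of_lt ?_ hbd
      rw [← smul_eq_C_mul]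
      exact degree_smul_le _ _
    have hgm : (g + C (p ^ (k + 1)) * b).Monic := hg.add_of_left hbd'
    have hgd' : (g + C (p ^ (k + 1)) * b).natDegree = g.natDegree :=
      natDegree_add_eq_left_of_degree_lt hbd'
    have hw1d : (C p * w1).natDegree ≤ w.natDegree := by
      have : C p * w1 = w - C 1 := by rw [hw]; simp
      rw [this, natDegree_sub_C]
    have hCw : ∀ (c : ℤ) (q : ℤ[X]), (C c * q).natDegree ≤ q.natDegree :=
      fun c q => natDegree_C_mul_le _ _
    refine ⟨w + C (p ^ (k + 1)) * a, g + C (p ^ (k + 1)) * b,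
      -(w1 * b) - C (p ^ k) * (a * b), w1 + C (p ^ k) * a, ?_, hgm, by omega, ?_, ?_, ?_⟩
    · rw [e1, ← hab, hw]
      simp only [C_pow]
      ring
    · rw [hw]; simp only [C_pow]; ring
    · rw [hgd']
      have h3 := natDegree_add_le w (C (p ^ (k + 1)) * a)
      have h4 := hCw (p ^ (k + 1)) a
      have : max w.natDegree (C (p ^ (k + 1)) * a).natDegree ≤ s - g.natDegree := by
        apply max_le <;> omega
      omega
    · have h5 : (w1 * b).natDegree ≤ s := by
        · have : w1.natDegree ≤ w.natDegree := by rwa [natDegree_C_mul hp] at hw1d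
          have := natDegree_mul_le (p := w1) (q := b)
          omega
      have h6 : (C (p ^ k) * (a * b)).natDegree ≤ s := by
        have := natDegree_mul_le (p := a) (q := b)
        have := hCw (p ^ k) (a * b)
        omega
      refine (natDegree_sub_le _ _).trans (max_le ?_ h6)
      rwa [natDegree_neg]

lemma normalizeMinor (p : ℕ) [Fact p.Prime] (s : ℕ) (δ : ℤ[X]) (hδ : ¬ C (p : ℤ) ∣ δ)
    (hs : δ.natDegree ≤ s) :
    ∃ (a : ℤ) (f0 f1 : ℤ[X]), ¬ (p : ℤ) ∣ a ∧ C a * δ = f0 + C (p : ℤ) * f1 ∧ f0.Monic ∧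
      f0.natDegree ≤ s ∧ f1.natDegree ≤ s := by
  have hp0 : (p : ℤ) ≠ 0 := by exact_mod_cast (Fact.out : p.Prime).ne_zero
  let φ := Int.castRingHom (ZMod p)
  have key : ∀ q : ℤ[X], q.map φ = 0 → C (p : ℤ) ∣ q := by
    intro q hq
    rw [C_dvd_iff_dvd_coeff]
    intro i
    have := congrArg (fun r => r.coeff i) hq
    simp only [coeff_map, coeff_zero, φ, eq_intCast] at this
    exact (ZMod.intCast_zmod_eq_zero_iff_dvd _ _).1 this
  have hδ0 : δ.map φ ≠ 0 := fun h => hδ (key _ h)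
  obtain ⟨a, ha⟩ := ZMod.intCast_surjective ((δ.map φ).leadingCoeff⁻¹)
  have hlc : (δ.map φ).leadingCoeff ≠ 0 := leadingCoeff_ne_zero.2 hδ0
  have hmon : ((C a * δ).map φ).Monic := by
    rw [Polynomial.map_mul, map_C]
    simp only [φ, eq_intCast, ha]
    rw [mul_comm]
    exact monic_mul_leadingCoeff_inv hδ0
  have hl : (C a * δ).map φ ∈ lifts φ := ⟨_, rfl⟩
  obtain ⟨f0, hf0, hd, hm⟩ := lifts_and_natDegree_eq_and_monic hl hmon
  have hd' : f0.natDegree ≤ s := by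
    rw [hd]
    exact natDegree_map_le.trans ((natDegree_C_mul_le _ _).trans hs)
  obtain ⟨f1, hf1⟩ := key (C a * δ - f0) (by rw [Polynomial.map_sub, hf0, sub_self])
  refine ⟨a, f0, f1, ?_, by rw [← hf1]; ring, hm, hd', ?_⟩
  · intro h
    rw [(ZMod.intCast_zmod_eq_zero_iff_dvd _ _).2 h] at ha
    exact inv_ne_zero hlc ha.symm
  · rw [← natDegree_C_mul hp0, ← hf1]
    exact (natDegree_sub_le _ _).trans (max_le ((natDegree_C_mul_le _ _).trans hs) hd')

/-- polynomial vector from coefficients -/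
noncomputable def polyVec {R : Type*} [CommRing R] {m B : ℕ} (x : Fin m × Fin (B + 1) → R) (j : Fin m) : R[X] :=
  ∑ l : Fin (B + 1), monomial (l : ℕ) (x (j, l))

/-- coefficient matrix of multiplication by `F` on polynomials of degree at most `B` -/
noncomputable def coeffMat {R : Type*} [CommRing R] {n m : ℕ} (F : Matrix (Fin n) (Fin m) R[X]) (B s : ℕ) :
    Matrix (Fin n × Fin (B + s + 1)) (Fin m × Fin (B + 1)) R :=
  fun ik jl => (F ik.1 jl.1 * X ^ (jl.2 : ℕ)).coeff ik.2

lemma coeffMat_mulVec {R : Type*} [CommRing R] {n m : ℕ} (F : Matrix (Fin n) (Fin m) R[X]) (B s : ℕ)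
    (x : Fin m × Fin (B + 1) → R) (i : Fin n) (k : Fin (B + s + 1)) :
    (coeffMat F B s).mulVec x (i, k) = (F.mulVec (polyVec x) i).coeff k := by
  simp only [Matrix.mulVec, dotProduct, coeffMat, polyVec, Finset.mul_sum, finsetSum_coeff]
  rw [Fintype.sum_prod_type]
  refine Finset.sum_congr rfl fun j _ => Finset.sum_congr rfl fun l _ => ?_
  rw [← C_mul_X_pow_eq_monomial, mul_left_comm, coeff_C_mul, mul_comm]

lemma polyVec_natDegree {R : Type*} [CommRing R] {m B : ℕ} (x : Fin m × Fin (B + 1) → R) (j : Fin m) :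
    (polyVec x j).natDegree ≤ B := by
  refine natDegree_sum_le_of_forall_le _ _ fun l _ => ?_
  exact (natDegree_monomial_le _).trans (Nat.lt_succ_iff.1 l.2)

lemma polyVec_coeff {R : Type*} [CommRing R] {m B : ℕ} (y : Fin m → R[X]) (hy : ∀ j, (y j).natDegree ≤ B) :
    polyVec (B := B) (fun jl => (y jl.1).coeff jl.2) = y := by
  funext j
  simp only [polyVec]
  rw [Fin.sum_univ_eq_sum_range (fun l => monomial l ((y j).coeff l))]
  exact ((y j).as_sum_range' (B + 1) (Nat.lt_succ_of_le (hy j))).symm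

lemma mulVec_natDegree {R : Type*} [CommRing R] {n m B s : ℕ} (F : Matrix (Fin n) (Fin m) R[X])
    (hF : ∀ i j, (F i j).natDegree ≤ s) (y : Fin m → R[X]) (hy : ∀ j, (y j).natDegree ≤ B)
    (i : Fin n) : (F.mulVec y i).natDegree ≤ B + s := by
  simp only [Matrix.mulVec, dotProduct]
  refine natDegree_sum_le_of_forall_le _ _ fun j _ => ?_
  have h1 : (F i j * y j).natDegree ≤ _ := natDegree_mul_le
  have := hF i j
  have := hy j
  omega

lemma coeffMat_eq {R : Type*} [CommRing R] {n m : ℕ} (F : Matrix (Fin n) (Fin m) R[X]) (B s : ℕ)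
    (hF : ∀ i j, (F i j).natDegree ≤ s) (b : Fin n → R[X]) (hb : ∀ i, (b i).natDegree ≤ B + s)
    (x : Fin m × Fin (B + 1) → R)
    (hx : (coeffMat F B s).mulVec x = fun ik => (b ik.1).coeff ik.2) :
    F.mulVec (polyVec x) = b := by
  funext i
  ext k
  by_cases hk : k < B + s + 1
  · rw [← coeffMat_mulVec F B s x i ⟨k, hk⟩, hx]
  · rw [coeff_eq_zero_of_natDegree_lt, coeff_eq_zero_of_natDegree_lt]
    · have := hb i
      omega
    · have := mulVec_natDegree F hF (polyVec x) (polyVec_natDegree x) i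
      omega

lemma polyVec_sub_smul {R : Type*} [CommRing R] {m B : ℕ} (x w : Fin m × Fin (B + 1) → R) (c : R) (j : Fin m) :
    polyVec (x - c • w) j = polyVec x j - C c * polyVec w j := by
  simp only [polyVec, Finset.mul_sum, C_mul_monomial, ← Finset.sum_sub_distrib]
  refine Finset.sum_congr rfl fun l _ => ?_
  simp [map_sub]

lemma artinRees {ι κ : Type*} [Fintype ι] [Fintype κ] (T : Matrix ι κ ℤ) (p : ℤ) :
    ∃ k : ℕ, ∀ x : κ → ℤ, (∃ z, T.mulVec x = p ^ (k + 1) • z) →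
      ∃ w, T.mulVec (x - p • w) = 0 := by
  classical
  obtain ⟨k, hk⟩ := Ideal.exists_pow_inf_eq_pow_smul (Ideal.span {p}) (LinearMap.range T.mulVecLin)
  refine ⟨k, fun x ⟨z, hz⟩ => ?_⟩
  have h1 := hk (k + 1) (by omega)
  have h2 : T.mulVec x ∈ (Ideal.span {p} ^ (k + 1) • ⊤ ⊓ LinearMap.range T.mulVecLin :
      Submodule ℤ (ι → ℤ)) := by
    refine ⟨?_, ⟨x, rfl⟩⟩
    rw [hz, Ideal.span_singleton_pow]
    exact Submodule.smul_mem_smul (Ideal.mem_span_singleton_self _) trivial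
  rw [h1] at h2
  have h3 : T.mulVec x ∈ (Ideal.span {p} • LinearMap.range T.mulVecLin : Submodule ℤ (ι → ℤ)) := by
    have : k + 1 - k = 1 := by omega
    rw [this, pow_one] at h2
    exact Submodule.smul_mono le_rfl inf_le_right h2
  rw [Submodule.ideal_span_singleton_smul] at h3
  obtain ⟨_, ⟨w, rfl⟩, hw⟩ := h3
  refine ⟨w, ?_⟩
  rw [Matrix.mulVec_sub, Matrix.mulVec_smul, ← hw]
  simp

lemma map_zmod_eq_zero {N : ℕ} (q : ℤ[X]) (hq : q.map (Int.castRingHom (ZMod N)) = 0) :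
    C (N : ℤ) ∣ q := by
  rw [C_dvd_iff_dvd_coeff]
  intro i
  have := congrArg (fun r => r.coeff i) hq
  simp only [coeff_map, coeff_zero, eq_intCast] at this
  exact (ZMod.intCast_zmod_eq_zero_iff_dvd _ _).1 this

lemma map_mulVec' {R S : Type*} [CommRing R] [CommRing S] (φ : R →+* S) {n m : ℕ}
    (F : Matrix (Fin n) (Fin m) R[X]) (y : Fin m → R[X]) (i : Fin n) :
    (F.mulVec y i).map φ = (F.map (Polynomial.map φ)).mulVec (fun j => (y j).map φ) i := by
  simp [Matrix.mulVec, dotProduct, Polynomial.map_sum]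

lemma stepK {n m s e : ℕ} (p : ℕ) (hp : p ≠ 0) (G : Matrix (Fin n) (Fin m) ℤ[X])
    (σ : Fin n → Fin m) (f f0 f1 : ℤ[X])
    (hG : ∀ i i', G i (σ i') = if i = i' then f else 0)
    (hdeg : ∀ i j, (G i j).natDegree ≤ s)
    (hf : f = f0 + C (p : ℤ) * f1) (hf0 : f0.Monic)
    (h0 : f0.natDegree ≤ s) (h1 : f1.natDegree ≤ s)
    (y l k0 : Fin m → ℤ[X]) (hk0 : ∀ j, k0 j = y j + C (p : ℤ) * l j)
    (hy : ∀ j, (y j).natDegree ≤ e) (hGk : G.mulVec k0 = 0) :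
    ∃ k : Fin m → ℤ[X], G.mulVec k = 0 ∧ (∀ j, (k j).natDegree ≤ e + 2 * s) ∧
      ∀ j, C (p : ℤ) ∣ k j - y j := by
  obtain ⟨k, hk⟩ := artinRees (coeffMat G (e + 2 * s) s) p
  obtain ⟨w, g, h, w1, hfw, hg, -, hw1, hwd, -⟩ :=
    hensel p (by exact_mod_cast hp) s f f0 f1 hf hf0 h0 h1 k
  set N := p ^ (k + 1) with hN
  let φ := Int.castRingHom (ZMod N)
  have hpN : (((p : ℤ) ^ (k + 1) : ℤ) : ZMod N) = 0 := by
    have : ((N : ℕ) : ZMod N) = 0 := ZMod.natCast_self N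
    rw [hN] at this
    exact_mod_cast this
  have hgm : (g.map φ).natDegree ≤ g.natDegree := natDegree_map_le
  have hwm : (w.map φ).natDegree ≤ w.natDegree := natDegree_map_le
  obtain ⟨κ, hκ0, hκd, hκy⟩ := coreA (s := s) (e := e) (φ p) (G.map (Polynomial.map φ)) σ (f.map φ)
    (w.map φ) (g.map φ) (w1.map φ) (by
      intro i i'
      simp only [Matrix.map_apply, hG]
      split_ifs <;> simp) (by
      intro i j
      exact natDegree_map_le.trans (hdeg i j)) (by
      rw [hfw]
      rw [Polynomial.map_add, Polynomial.map_mul, Polynomial.map_mul, map_C]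
      change _ + C (((p : ℤ) ^ (k + 1) : ℤ) : ZMod N) * _ = _
      rw [hpN, C_0, zero_mul, add_zero]) (hg.map φ) (by omega) (by
      rw [hw1]; simp [φ]) (fun j => (y j).map φ) (fun j => (l j).map φ) (fun j => (k0 j).map φ) (by
      intro j
      simp [hk0, φ]) (fun j => natDegree_map_le.trans (hy j)) (by
      funext i
      rw [← map_mulVec', hGk]
      simp)
  choose q hq using hκy
  let lft : ZMod N → ℤ := Function.surjInv ZMod.intCast_surjective
  have hlft : ∀ a : ZMod N, φ (lft a) = a := fun a => Function.surjInv_eq ZMod.intCast_surjective a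
  let x : Fin m × Fin (e + 2 * s + 1) → ℤ := fun jl => lft ((κ jl.1).coeff jl.2)
  have hx : ∀ j, (polyVec x j).map φ = κ j := by
    intro j
    rw [← congrFun (polyVec_coeff κ hκd) j]
    simp only [polyVec, Polynomial.map_sum, map_monomial, x, hlft]
  have hTx : ∃ z, (coeffMat G (e + 2 * s) s).mulVec x = (p : ℤ) ^ (k + 1) • z := by
    have : ∀ ik, ∃ c, (coeffMat G (e + 2 * s) s).mulVec x ik = (p : ℤ) ^ (k + 1) * c := by
      rintro ⟨i, c⟩
      rw [coeffMat_mulVec]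
      have h3 := map_mulVec' φ G (polyVec x) i
      simp only [hx] at h3
      rw [hκ0] at h3
      have h4 := (C_dvd_iff_dvd_coeff _ _).1 (map_zmod_eq_zero _ h3) c
      rw [hN] at h4
      exact_mod_cast h4
    choose z hz using this
    exact ⟨z, funext fun ik => by simp [hz]⟩
  obtain ⟨v, hv⟩ := hk x hTx
  refine ⟨polyVec (x - (p : ℤ) • v), ?_, polyVec_natDegree _, ?_⟩
  · apply coeffMat_eq G (e + 2 * s) s hdeg 0 (by simp)
    rw [hv]
    funext ik
    simp
  · intro j
    rw [polyVec_sub_smul]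
    obtain ⟨q', hq'⟩ := Polynomial.map_surjective φ ZMod.intCast_surjective (q j)
    have h5 : (polyVec x j - y j - C (p : ℤ) * q').map φ = 0 := by
      rw [Polynomial.map_sub, Polynomial.map_sub, hx, hq, Polynomial.map_mul, hq', map_C, sub_self]
    have h6 : C (p : ℤ) ∣ polyVec x j - y j - C (p : ℤ) * q' := by
      refine dvd_trans ?_ (map_zmod_eq_zero _ h5)
      refine map_dvd C ?_
      rw [hN]
      exact_mod_cast dvd_pow_self p (Nat.succ_ne_zero k)
    have h7 : polyVec x j - C (p : ℤ) * polyVec v j - y j =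
      (polyVec x j - y j - C (p : ℤ) * q') + C (p : ℤ) * (q' - polyVec v j) := by ring
    rw [h7]
    exact dvd_add h6 (dvd_mul_right _ _)

lemma pickCols {K ι κ : Type*} [Field K] [Fintype ι] [Fintype κ] (A : Matrix ι κ K) (r : ℕ)
    (hr : A.rank = r) : ∃ τ : Fin r → κ, LinearIndependent K (A.submatrix id τ).col ∧
      Submodule.span K (Set.range (A.submatrix id τ).col) =
        Submodule.span K (Set.range A.col) := by
  rw [Matrix.rank_eq_finrank_span_cols] at hr
  subst hr
  obtain ⟨f, hf, hspan, hli⟩ :=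
    Submodule.exists_fun_fin_finrank_span_eq K (Set.range A.col)
  choose τ hτ using hf
  have : (A.submatrix id τ).col = f := by
    funext i
    rw [← hτ i]
    rfl
  exact ⟨τ, by rwa [this], by rwa [this]⟩

lemma cramerBound {ι κ : Type*} [Fintype ι] [Fintype κ] (T : Matrix ι κ ℤ) (β : ι → ℤ)
    (H : ℝ) (hH : 1 ≤ H) (hT : ∀ i j, (|T i j| : ℝ) ≤ H) (c : ℤ) (hc : c ≠ 0) (x : κ → ℤ)
    (hx : T.mulVec x = c • β) :
    ∃ D : ℕ, 0 < D ∧ (D : ℝ) ≤ (Fintype.card ι).factorial * H ^ (Fintype.card ι) ∧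
      ∃ x' : κ → ℤ, T.mulVec x' = (D : ℤ) • β := by
  classical
  let φ := Int.castRingHom ℚ
  obtain ⟨ρ, hρ⟩ : ∃ r, (T.map φ).rank = r := ⟨_, rfl⟩
  obtain ⟨τ, hτ, hspan⟩ := pickCols (T.map φ) ρ hρ
  set S1 := (T.map φ).submatrix id τ with hS1
  have hr1 : S1.transpose.rank = ρ := by
    have := LinearIndependent.rank_matrix (M := S1.transpose) (by simpa using hτ)
    simpa using this
  obtain ⟨η, hη, -⟩ := pickCols S1.transpose ρ hr1
  have hρι : ρ ≤ Fintype.card ι := by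
    have := hτ.fintype_card_le_finrank
    simpa using this
  set S := T.submatrix η τ with hS
  have hSu : IsUnit (S.map φ) := by
    rw [← Matrix.isUnit_transpose, ← Matrix.linearIndependent_cols_iff_isUnit]
    exact hη
  have hdet : S.det ≠ 0 := by
    intro h0
    rw [Matrix.isUnit_iff_isUnit_det] at hSu
    have : (S.map φ).det = φ S.det := by rw [RingHom.map_det]; rfl
    rw [this, h0] at hSu
    simp at hSu
  -- rational solution
  have hβ : (fun i => (β i : ℚ)) ∈ Submodule.span ℚ (Set.range S1.col) := by
    rw [hspan]
    have h1 : (c : ℚ) • (fun i => (β i : ℚ)) ∈ Submodule.span ℚ (Set.range (T.map φ).col) := by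
      rw [← Matrix.range_mulVecLin]
      refine ⟨fun j => (x j : ℚ), ?_⟩
      funext i
      have := congrArg (fun z : ℤ => (z : ℚ)) (congrFun hx i)
      simpa [Matrix.mulVec, dotProduct, φ] using this
    have h2 := Submodule.smul_mem _ ((c : ℚ)⁻¹) h1
    rwa [smul_smul, inv_mul_cancel₀ (by exact_mod_cast hc), one_smul] at h2
  rw [← Matrix.range_mulVecLin] at hβ
  obtain ⟨u, hu⟩ := hβ
  have hu' : S1.mulVec u = fun i => (β i : ℚ) := hu
  let g : Fin ρ → ℤ := S.adjugate.mulVec (fun i => β (η i))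
  have hSu2 : (S.map φ).mulVec u = fun i => (β (η i) : ℚ) := by
    funext i
    exact congrFun hu' (η i)
  have hg : (fun i => (g i : ℚ)) = (S.det : ℚ) • u := by
    have h1 : (S.map φ).adjugate.mulVec ((S.map φ).mulVec u) = (S.det : ℚ) • u := by
      rw [Matrix.mulVec_mulVec, Matrix.adjugate_mul]
      have : (S.map φ).det = (S.det : ℚ) := by
        have : (S.map φ).det = φ S.det := by rw [RingHom.map_det]; rfl
        simpa using this
      rw [this, Matrix.smul_mulVec, Matrix.one_mulVec]
    rw [← h1, hSu2]
    have h2 : (S.map φ).adjugate = S.adjugate.map φ := by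
      have := RingHom.map_adjugate φ S
      exact this.symm
    rw [h2]
    funext i
    simp [g, Matrix.mulVec, dotProduct, φ]
  have hTg : (T.submatrix id τ).mulVec g = S.det • β := by
    funext i
    have h1 : S1.mulVec (fun i => (g i : ℚ)) i = (S.det : ℚ) * β i := by
      rw [hg, Matrix.mulVec_smul, hu']
      simp
    have h2 : (((T.submatrix id τ).mulVec g i : ℤ) : ℚ) = ((S.det • β) i : ℤ) := by
      simp only [Pi.smul_apply, smul_eq_mul, Int.cast_mul]
      rw [← h1]
      simp [S1, Matrix.mulVec, dotProduct, φ]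
    exact_mod_cast h2
  refine ⟨S.det.natAbs, Int.natAbs_pos.2 hdet, ?_, ?_⟩
  · have h1 := Matrix.det_le (A := S.map (Int.castRingHom ℝ))
      (abv := (AbsoluteValue.abs : AbsoluteValue ℝ ℝ)) (x := H) (by
        intro i j
        exact hT (η i) (τ j))
    have h2 : (S.map (Int.castRingHom ℝ)).det = (S.det : ℝ) := by
      have : (S.map (Int.castRingHom ℝ)).det = (Int.castRingHom ℝ) S.det := by
        rw [RingHom.map_det]; rfl
      simpa using this
    rw [h2] at h1
    simp only [AbsoluteValue.abs_apply, Fintype.card_fin, nsmul_eq_mul] at h1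
    have h3 : ((S.det.natAbs : ℕ) : ℝ) = |(S.det : ℝ)| := by
      rw [Nat.cast_natAbs]; simp
    rw [h3]
    refine h1.trans ?_
    have h4 : ((ρ.factorial : ℕ) : ℝ) ≤ (Fintype.card ι).factorial := by
      exact_mod_cast Nat.factorial_le hρι
    have h5 : H ^ ρ ≤ H ^ Fintype.card ι := pow_le_pow_right₀ hH hρι
    gcongr
  · have h6 : ∀ g' : Fin ρ → ℤ, ∃ x', T.mulVec x' = (T.submatrix id τ).mulVec g' := by
      intro g'
      refine ⟨∑ i, Pi.single (τ i) (g' i), ?_⟩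
      rw [Matrix.mulVec_sum]
      funext k
      simp only [Finset.sum_apply, Matrix.mulVec_single, Matrix.mulVec, dotProduct]
      simp
    obtain ⟨x', hx'⟩ := h6 (S.det.sign • g)
    refine ⟨x', ?_⟩
    rw [hx', Matrix.mulVec_smul, hTg, smul_smul, Int.sign_mul_self_eq_natAbs]

lemma det_natDegree {n d : ℕ} (A : Matrix (Fin n) (Fin n) ℤ[X])
    (hA : ∀ i j, (A i j).natDegree ≤ d) : A.det.natDegree ≤ n * d := by
  rw [Matrix.det_apply]
  refine natDegree_sum_le_of_forall_le _ _ fun σ _ => ?_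
  refine (natDegree_smul_le _ _).trans ?_
  refine (natDegree_prod_le _ _).trans ?_
  refine (Finset.sum_le_card_nsmul _ _ d fun i _ => hA _ _).trans ?_
  simp

lemma adj_mul_entry {n m : ℕ} (F : Matrix (Fin n) (Fin m) ℤ[X]) (σ : Fin n → Fin m) (i : Fin n)
    (j : Fin m) : ((F.submatrix id σ).adjugate * F) i j =
      (F.submatrix id (Function.update σ i j)).det := by
  have h1 : ((F.submatrix id σ).adjugate * F) i j =
      (F.submatrix id σ).adjugate.mulVec (fun l => F l j) i := rfl
  rw [h1, ← Matrix.cramer_eq_adjugate_mulVec, Matrix.cramer_apply]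
  congr 1
  ext1 a b
  by_cases hb : b = i
  · subst hb; simp
  · simp [hb]

lemma pseudoDiv (δ : ℤ[X]) (N : ℕ) : ∀ y : ℤ[X], y.natDegree ≤ δ.natDegree + N →
    ∃ q r : ℤ[X], C (δ.leadingCoeff ^ N) * y = δ * q + r ∧ r.natDegree ≤ δ.natDegree := by
  induction N with
  | zero => intro y hy; exact ⟨0, y, by simp, by simpa using hy⟩
  | succ N ih =>
    intro y hy
    let t := C (y.coeff (δ.natDegree + (N + 1))) * X ^ (N + 1)
    obtain ⟨q, r, h1, h2⟩ := ih (C δ.leadingCoeff * y - δ * t) (by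
      rw [natDegree_le_iff_coeff_eq_zero]
      intro k hk
      rw [coeff_sub, coeff_C_mul]
      have e1 : (δ * t).coeff k = y.coeff (δ.natDegree + (N + 1)) * (δ * X ^ (N + 1)).coeff k := by
        rw [← coeff_C_mul]; congr 1; simp only [t]; ring
      rw [e1]
      rcases Nat.lt_or_ge (δ.natDegree + (N + 1)) k with h | h
      · rw [coeff_eq_zero_of_natDegree_lt (p := y) (by omega), coeff_mul_X_pow',
          if_pos (by omega), coeff_eq_zero_of_natDegree_lt (p := δ) (by omega)]
        ring
      · have : k = δ.natDegree + (N + 1) := by omega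
        subst this
        rw [coeff_mul_X_pow]
        simp only [leadingCoeff]
        ring)
    refine ⟨q + C (δ.leadingCoeff ^ N) * t, r, ?_, h2⟩
    rw [pow_succ, C_mul]
    linear_combination h1

lemma exists_minor {n m : ℕ} (F : Matrix (Fin n) (Fin m) ℤ[X])
    (hrank : (F.map fun q =>
      algebraMap (Polynomial ℚ) (RatFunc ℚ) (q.map (Int.castRingHom ℚ))).rank = n) :
    ∃ σ : Fin n → Fin m, (F.submatrix id σ).det ≠ 0 := by
  obtain ⟨σ, hσ, -⟩ := pickCols _ n hrank
  refine ⟨σ, fun h0 => ?_⟩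
  rw [Matrix.linearIndependent_cols_iff_isUnit, Matrix.isUnit_iff_isUnit_det] at hσ
  let ψ : ℤ[X] →+* RatFunc ℚ :=
    (algebraMap (Polynomial ℚ) (RatFunc ℚ)).comp (mapRingHom (Int.castRingHom ℚ))
  have h1 := RingHom.map_det ψ (F.submatrix id σ)
  rw [h0, map_zero] at h1
  have h2 : (ψ.mapMatrix (F.submatrix id σ)) = (F.map fun q =>
      algebraMap (Polynomial ℚ) (RatFunc ℚ) (q.map (Int.castRingHom ℚ))).submatrix id σ := rfl
  rw [← h2, ← h1] at hσ
  simp at hσ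

lemma adj_mul_sel {n m : ℕ} (F : Matrix (Fin n) (Fin m) ℤ[X]) (σ : Fin n → Fin m) (i i' : Fin n) :
    ((F.submatrix id σ).adjugate * F) i (σ i') =
      if i = i' then (F.submatrix id σ).det else 0 := by
  have h1 : ((F.submatrix id σ).adjugate * F) i (σ i') =
      ((F.submatrix id σ).adjugate * (F.submatrix id σ)) i i' := rfl
  rw [h1, Matrix.adjugate_mul, Matrix.smul_apply, Matrix.one_apply]
  simp

lemma ker_iff {n m : ℕ} (F : Matrix (Fin n) (Fin m) ℤ[X]) (σ : Fin n → Fin m)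
    (hσ : (F.submatrix id σ).det ≠ 0) (k : Fin m → ℤ[X])
    (h : ((F.submatrix id σ).adjugate * F).mulVec k = 0) : F.mulVec k = 0 := by
  rw [← Matrix.mulVec_mulVec] at h
  have h1 := congrArg (F.submatrix id σ).mulVec h
  rw [Matrix.mulVec_mulVec, Matrix.mul_adjugate, Matrix.smul_mulVec, Matrix.one_mulVec,
    Matrix.mulVec_zero] at h1
  exact (smul_eq_zero.1 h1).resolve_left hσ

lemma stepF {n m d e : ℕ} (F : Matrix (Fin n) (Fin m) ℤ[X]) (hF : ∀ i j, (F i j).natDegree ≤ d)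
    (σ0 : Fin n → Fin m) (hσ0 : (F.submatrix id σ0).det ≠ 0) (p : ℕ) [hpf : Fact p.Prime]
    (b y' y0 : _) (h1 : F.mulVec y' = C (p : ℤ) • b) (h0 : F.mulVec y0 = b)
    (hy : ∀ j, (y' j).natDegree ≤ e) :
    ∃ y, F.mulVec y = b ∧ ∀ j, (y j).natDegree ≤ e + 2 * (n * d) := by
  classical
  have hp0 : (p : ℤ) ≠ 0 := by exact_mod_cast hpf.out.ne_zero
  have hpp : Prime (C (p : ℤ)) := prime_C_iff.2 (Nat.prime_iff_prime_int.1 hpf.out)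
  have hex : ∃ v : ℕ, ∃ σ : Fin n → Fin m, ¬ C (p : ℤ) ^ (v + 1) ∣ (F.submatrix id σ).det := by
    obtain ⟨v, hv⟩ := FiniteMultiplicity.of_prime_left hpp hσ0
    exact ⟨v, σ0, hv⟩
  obtain ⟨v, ⟨σ, hσ⟩, hmin⟩ : ∃ v : ℕ, (∃ σ : Fin n → Fin m,
      ¬ C (p : ℤ) ^ (v + 1) ∣ (F.submatrix id σ).det) ∧
      ∀ σ : Fin n → Fin m, C (p : ℤ) ^ v ∣ (F.submatrix id σ).det := by
    refine ⟨Nat.find hex, Nat.find_spec hex, fun σ => ?_⟩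
    rcases hv : Nat.find hex with _ | u
    · simp
    · by_contra hcon
      exact Nat.find_min hex (m := u) (by omega) ⟨σ, hcon⟩
  have hdet0 : (F.submatrix id σ).det ≠ 0 := by
    intro h; rw [h] at hσ; exact hσ (dvd_zero _)
  obtain ⟨δ, hδ⟩ := hmin σ
  have hpv : C (p : ℤ) ^ v ≠ 0 := pow_ne_zero _ hpp.ne_zero
  have hpδ : ¬ C (p : ℤ) ∣ δ := by
    rintro ⟨t, rfl⟩
    exact hσ ⟨t, by rw [hδ]; ring⟩
  have hG0 : ∀ i j, ∃ t, ((F.submatrix id σ).adjugate * F) i j = C (p : ℤ) ^ v * t := by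
    intro i j
    rw [adj_mul_entry]
    exact hmin _
  choose G0 hG0 using hG0
  have hdegC : ∀ q : ℤ[X], (C (p : ℤ) ^ v * q).natDegree = q.natDegree := by
    intro q
    rw [← C_pow, natDegree_C_mul (pow_ne_zero _ hp0)]
  have hG0d : ∀ i j, (G0 i j).natDegree ≤ n * d := by
    intro i j
    rw [← hdegC, ← hG0, adj_mul_entry]
    exact det_natDegree _ fun _ _ => hF _ _
  have hδd : δ.natDegree ≤ n * d := by
    rw [← hdegC, ← hδ]
    exact det_natDegree _ fun _ _ => hF _ _
  obtain ⟨a, f0, f1, ha, haf, hm, hd0, hd1⟩ := normalizeMinor p (n * d) δ hpδ hδd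
  have ha0 : a ≠ 0 := by rintro rfl; simp at ha
  let G : Matrix (Fin n) (Fin m) ℤ[X] := fun i j => C a * G0 i j
  have hGF : C (p : ℤ) ^ v • G = C a • ((F.submatrix id σ).adjugate * F) := by
    ext1 i j
    rw [Matrix.smul_apply, Matrix.smul_apply, hG0]
    change C (p : ℤ) ^ v * (C a * G0 i j) = C a * (C (p : ℤ) ^ v * G0 i j)
    ring
  have hker : ∀ k, G.mulVec k = 0 ↔ F.mulVec k = 0 := by
    intro k
    have h2 : C (p : ℤ) ^ v • G.mulVec k =
        C a • ((F.submatrix id σ).adjugate * F).mulVec k := by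
      rw [← Matrix.smul_mulVec, hGF, Matrix.smul_mulVec]
    constructor
    · intro h3
      rw [h3, smul_zero] at h2
      exact ker_iff F σ hdet0 k ((smul_eq_zero.1 h2.symm).resolve_left (by simpa using ha0))
    · intro h3
      rw [← Matrix.mulVec_mulVec, h3, Matrix.mulVec_zero, smul_zero] at h2
      exact (smul_eq_zero.1 h2).resolve_left hpv
  obtain ⟨k, hk0, hkd, hky⟩ := stepK (s := n * d) (e := e) p hpf.out.ne_zero G σ (C a * δ) f0 f1 (by
      intro i i'
      have h2 := hG0 i (σ i')
      rw [adj_mul_sel, hδ] at h2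
      simp only [G]
      split_ifs at h2 ⊢ with hii
      · rw [mul_left_cancel₀ hpv h2]
      · rw [(mul_eq_zero.1 h2.symm).resolve_left hpv, mul_zero]) (by
      intro i j
      exact (natDegree_C_mul_le _ _).trans (hG0d i j)) haf hm hd0 hd1 y' (fun j => - y0 j)
      (y' - C (p : ℤ) • y0) (by intro j; simp; ring) hy (by
      rw [hker, Matrix.mulVec_sub, Matrix.mulVec_smul, h1, h0, sub_self])
  choose z hz using hky
  refine ⟨-z, ?_, ?_⟩
  · have h2 : C (p : ℤ) • (-z) = y' - k := by
      funext j
      have := hz j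
      simp only [Pi.smul_apply, Pi.neg_apply, Pi.sub_apply, smul_eq_mul]
      linear_combination this
    have h3 : C (p : ℤ) • F.mulVec (-z) = C (p : ℤ) • b := by
      rw [← Matrix.mulVec_smul, h2, Matrix.mulVec_sub, h1, (hker k).1 hk0, sub_zero]
    exact smul_right_injective _ hpp.ne_zero h3
  · intro j
    rw [Pi.neg_apply, natDegree_neg, ← natDegree_C_mul hp0, ← hz]
    refine (natDegree_sub_le _ _).trans (max_le (hkd j) ?_)
    have := hy j
    omega

lemma iterF {n m d : ℕ} (F : Matrix (Fin n) (Fin m) ℤ[X]) (hF : ∀ i j, (F i j).natDegree ≤ d)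
    (σ0 : Fin n → Fin m) (hσ0 : (F.submatrix id σ0).det ≠ 0)
    (b : Fin n → ℤ[X]) (y0 : Fin m → ℤ[X]) (h0 : F.mulVec y0 = b) (K : ℕ) :
    ∀ (D e : ℕ) (y' : Fin m → ℤ[X]), 0 < D → D < 2 ^ (K + 1) → F.mulVec y' = C (D : ℤ) • b →
      (∀ j, (y' j).natDegree ≤ e) →
      ∃ y, F.mulVec y = b ∧ ∀ j, (y j).natDegree ≤ e + 2 * (n * d) * K := by
  induction K with
  | zero =>
    intro D e y' hD hD2 hy' he
    have : D = 1 := by omega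
    subst this
    exact ⟨y', by simpa using hy', by simpa using he⟩
  | succ K ih =>
    intro D e y' hD hD2 hy' he
    by_cases hD1 : D = 1
    · subst hD1
      exact ⟨y', by simpa using hy', fun j => (he j).trans (Nat.le_add_right _ _)⟩
    have hp : D.minFac.Prime := Nat.minFac_prime hD1
    have : Fact D.minFac.Prime := ⟨hp⟩
    obtain ⟨D', hD'⟩ := Nat.minFac_dvd D
    set p := D.minFac with hpdef
    have hD'0 : 0 < D' := by
      rcases Nat.eq_zero_or_pos D' with h | h
      · rw [h] at hD'; omega
      · exact h
    have hlt : D' < 2 ^ (K + 1) := by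
      have h2 : 2 * D' ≤ p * D' := Nat.mul_le_mul_right _ hp.two_le
      rw [← hD'] at h2
      have : 2 ^ (K + 1 + 1) = 2 * 2 ^ (K + 1) := by ring
      omega
    obtain ⟨y1, hy1, hd1⟩ := stepF F hF σ0 hσ0 p (C (D' : ℤ) • b) y' (C (D' : ℤ) • y0) (by
      rw [hy', smul_smul, ← C_mul]
      congr 2
      rw [hD']; push_cast; rfl) (by rw [Matrix.mulVec_smul, h0]) he
    obtain ⟨y, hy, hd⟩ := ih D' (e + 2 * (n * d)) y1 hD'0 hlt hy1 hd1
    refine ⟨y, hy, fun j => (hd j).trans (le_of_eq ?_)⟩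
    ring

lemma degQ {n m d : ℕ} (F : Matrix (Fin n) (Fin m) ℤ[X]) (hF : ∀ i j, (F i j).natDegree ≤ d)
    (σ : Fin n → Fin m) (hσ : (F.submatrix id σ).det ≠ 0)
    (b : Fin n → ℤ[X]) (hb : ∀ i, (b i).natDegree ≤ d) (y : Fin m → ℤ[X]) (h0 : F.mulVec y = b) :
    ∃ (c : ℤ) (z : Fin m → ℤ[X]), c ≠ 0 ∧ F.mulVec z = C c • b ∧
      ∀ j, (z j).natDegree ≤ n * d := by
  classical
  set A := F.submatrix id σ with hA
  set δ := A.det with hδ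
  set N := ∑ j, (y j).natDegree with hN
  have hq : ∀ j, ∃ q r : ℤ[X], C (δ.leadingCoeff ^ N) * y j = δ * q + r ∧
      r.natDegree ≤ δ.natDegree := fun j => pseudoDiv δ N (y j) (by
        have : (y j).natDegree ≤ N :=
          Finset.single_le_sum (f := fun j => (y j).natDegree) (fun _ _ => Nat.zero_le _)
            (Finset.mem_univ j)
        omega)
  choose q r hqr hr using hq
  have hδd : δ.natDegree ≤ n * d := det_natDegree _ fun _ _ => hF _ _
  set c := δ.leadingCoeff ^ N with hc
  have hc0 : c ≠ 0 := pow_ne_zero _ (leadingCoeff_ne_zero.2 hσ)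
  let E : Matrix (Fin m) (Fin n) ℤ[X] := fun j i => if σ i = j then 1 else 0
  have hFE : F * E = A := by
    ext1 i i'
    rw [Matrix.mul_apply]
    simp [E, hA]
  have hE : ∀ (v : Fin n → ℤ[X]) j, j ∉ Set.range σ → E.mulVec v j = 0 := by
    intro v j hj
    simp only [Matrix.mulVec, dotProduct, E]
    refine Finset.sum_eq_zero fun i _ => ?_
    rw [if_neg (fun h => hj ⟨i, h⟩), zero_mul]
  let z : Fin m → ℤ[X] := C c • y - (δ • q - E.mulVec ((A.adjugate * F).mulVec q))
  have hFz : F.mulVec z = C c • b := by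
    simp only [z, Matrix.mulVec_sub, Matrix.mulVec_smul, h0, Matrix.mulVec_mulVec]
    rw [← Matrix.mul_assoc, hFE, ← Matrix.mul_assoc, Matrix.mul_adjugate, Matrix.smul_mul,
      Matrix.one_mul, Matrix.smul_mulVec]
    simp [hδ]
  have hz : ∀ j, j ∉ Set.range σ → z j = r j := by
    intro j hj
    simp only [z, Pi.sub_apply, Pi.smul_apply, hE _ j hj, smul_eq_mul, hqr]
    ring
  refine ⟨c, z, hc0, hFz, fun j => ?_⟩
  by_cases hj : j ∈ Set.range σ
  · obtain ⟨i, rfl⟩ := hj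
    have h1 : ((A.adjugate * F).mulVec z) i = C c * A.cramer b i := by
      rw [← Matrix.mulVec_mulVec, hFz, Matrix.mulVec_smul, Matrix.cramer_eq_adjugate_mulVec]
      rfl
    have h2 : (A.cramer b i).natDegree ≤ n * d := by
      rw [Matrix.cramer_apply]
      refine det_natDegree _ fun k l => ?_
      by_cases hl : l = i
      · subst hl; simpa using hb k
      · simpa [hl, hA] using hF k (σ l)
    simp only [Matrix.mulVec, dotProduct] at h1
    rw [← Finset.add_sum_erase _ _ (Finset.mem_univ (σ i)), adj_mul_sel, if_pos rfl] at h1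
    set ρ := ∑ x ∈ Finset.univ.erase (σ i), (A.adjugate * F) i x * z x with hρ
    have h3 : ρ.natDegree ≤ n * d + δ.natDegree := by
      refine natDegree_sum_le_of_forall_le _ _ fun x hx => ?_
      by_cases hxr : x ∈ Set.range σ
      · obtain ⟨i', rfl⟩ := hxr
        rw [adj_mul_sel, if_neg]
        · simp
        · rintro rfl
          simp at hx
      · rw [hz x hxr]
        refine natDegree_mul_le.trans (add_le_add ?_ (hr x))
        rw [adj_mul_entry]
        exact det_natDegree _ fun _ _ => hF _ _
    have h4 : δ * z (σ i) = C c * A.cramer b i - ρ := by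
      linear_combination h1
    have h5 : (δ * z (σ i)).natDegree ≤ n * d + δ.natDegree := by
      rw [h4]
      refine (natDegree_sub_le _ _).trans (max_le ?_ h3)
      refine (natDegree_C_mul_le _ _).trans ?_
      omega
    by_cases hz0 : z (σ i) = 0
    · rw [hz0]; simp
    · rw [natDegree_mul hσ hz0] at h5
      omega
  · rw [hz j hj]
    exact (hr j).trans hδd

lemma coeff_le_exp (f : ℤ[X]) (h : ℝ) (hf : polyHeight f ≤ h) (k : ℕ) :
    |((f.coeff k : ℤ) : ℝ)| ≤ Real.exp h := by
  by_cases h0 : f.coeff k = 0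
  · rw [h0]
    simp only [Int.cast_zero, abs_zero]
    exact (Real.exp_pos h).le
  have hk : k ∈ Finset.range (f.natDegree + 1) := by
    rw [Finset.mem_range, Nat.lt_succ_iff]
    exact le_natDegree_of_ne_zero h0
  have h1 : (f.coeff k).natAbs ≤
      (Finset.range (f.natDegree + 1)).sup fun k => (f.coeff k).natAbs :=
    Finset.le_sup (f := fun k => (f.coeff k).natAbs) hk
  have hpos : 0 < (f.coeff k).natAbs := Int.natAbs_pos.2 h0
  have h3 : |((f.coeff k : ℤ) : ℝ)| = ((f.coeff k).natAbs : ℝ) := by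
    rw [Nat.cast_natAbs]; simp
  rw [h3]
  refine le_trans (Nat.cast_le.2 h1) ?_
  have h4 : (0 : ℝ) < (((Finset.range (f.natDegree + 1)).sup
      fun k => (f.coeff k).natAbs : ℕ) : ℝ) := by
    exact_mod_cast lt_of_lt_of_le hpos h1
  exact (Real.log_le_iff_le_exp h4).1 hf

/-- Let F ∈ ℤ[x]^{n×m} have full row rank n over ℚ(x) and b ∈ ℤ[x]^n, with
d = max(deg F, deg b) ≥ 1 and h = max(height F, height b). If F·y = b has a solution in
ℤ[x]^m, then it has one of degree ≤ 3n²d²(2h₂ + log(nd+1)) + nd, where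
h₂ = 2(n(n+1)d + n)(h + log(n(n+1)d + n) + 1). -/
theorem stmt16 {n m : ℕ} (F : Matrix (Fin n) (Fin m) (Polynomial ℤ))
    (b : Fin n → Polynomial ℤ)
    (hrank : (F.map fun q =>
      algebraMap (Polynomial ℚ) (RatFunc ℚ) (q.map (Int.castRingHom ℚ))).rank = n)
    (d : ℕ) (hd1 : 1 ≤ d) (hdF : ∀ i j, (F i j).natDegree ≤ d)
    (hdb : ∀ i, (b i).natDegree ≤ d)
    (h : ℝ) (hhF : ∀ i j, polyHeight (F i j) ≤ h) (hhb : ∀ i, polyHeight (b i) ≤ h)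
    (hsol : ∃ y : Fin m → Polynomial ℤ, F.mulVec y = b) :
    ∃ y : Fin m → Polynomial ℤ, F.mulVec y = b ∧
      ∀ j, ((y j).natDegree : ℝ) ≤
        3 * (n : ℝ) ^ 2 * (d : ℝ) ^ 2 *
          (2 * (2 * ((n : ℝ) * ((n : ℝ) + 1) * (d : ℝ) + (n : ℝ)) *
            (h + Real.log ((n : ℝ) * ((n : ℝ) + 1) * (d : ℝ) + (n : ℝ)) + 1)) +
           Real.log ((n : ℝ) * (d : ℝ) + 1)) + (n : ℝ) * (d : ℝ) := by
  classical
  rcases Nat.eq_zero_or_pos n with hn | hn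
  · subst hn
    exact ⟨0, Subsingleton.elim _ _, fun j => by simp⟩
  obtain ⟨y0, hy0⟩ := hsol
  obtain ⟨σ, hσ⟩ := exists_minor F hrank
  have hh0 : 0 ≤ h := by
    refine le_trans ?_ (hhF ⟨0, hn⟩ (σ ⟨0, hn⟩))
    exact Real.log_natCast_nonneg _
  have hH1 : 1 ≤ Real.exp h := Real.one_le_exp hh0
  have hcoef : ∀ i j k, |(((F i j).coeff k : ℤ) : ℝ)| ≤ Real.exp h :=
    fun i j k => coeff_le_exp (F i j) h (hhF i j) k
  obtain ⟨c, z, hc, hz, hzd⟩ := degQ F hdF σ hσ b hdb y0 hy0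
  obtain ⟨D, hD, hDle, x', hx'⟩ := cramerBound (coeffMat F (n * d) d)
    (fun ik => (b ik.1).coeff ik.2) (Real.exp h) hH1 (by
      intro ik jl
      simp only [coeffMat, coeff_mul_X_pow']
      split_ifs
      · exact hcoef _ _ _
      · simp only [Int.cast_zero, abs_zero]
        exact (Real.exp_pos h).le) c hc (fun jl => (z jl.1).coeff jl.2) (by
      funext ik
      rw [coeffMat_mulVec F (n * d) d _ ik.1 ik.2, polyVec_coeff z hzd, hz]
      simp)
  have hFx : F.mulVec (polyVec x') = C (D : ℤ) • b := by
    refine coeffMat_eq F (n * d) d hdF _ (fun i => ?_) x' ?_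
    · have h1 : (C (D : ℤ) * b i).natDegree ≤ (b i).natDegree := natDegree_C_mul_le _ _
      have h2 := hdb i
      simp only [Pi.smul_apply, smul_eq_mul]
      omega
    · rw [hx']
      funext ik
      simp only [Pi.smul_apply, smul_eq_mul, coeff_C_mul]
  obtain ⟨y, hy, hyd⟩ := iterF F hdF σ hσ b y0 hy0 (Nat.log 2 D) D (n * d) (polyVec x') hD
    (Nat.lt_pow_succ_log_self (by norm_num) D) hFx (polyVec_natDegree x')
  refine ⟨y, hy, fun j => ?_⟩
  set N : ℕ := n * (n * d + d + 1) with hN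
  have hcard : Fintype.card (Fin n × Fin (n * d + d + 1)) = N := by simp [hN]
  rw [hcard] at hDle
  have hNr : (n : ℝ) * ((n : ℝ) + 1) * (d : ℝ) + (n : ℝ) = (N : ℝ) := by
    rw [hN]; push_cast; ring
  rw [hNr]
  have hN1 : 1 ≤ N := Nat.mul_pos hn (by omega)
  have hNR : (1 : ℝ) ≤ N := by exact_mod_cast hN1
  have hL : 0 ≤ Real.log N := Real.log_nonneg hNR
  have hlogD : Real.log D ≤ N * Real.log N + N * h := by
    have h1 : (D : ℝ) ≤ (N : ℝ) ^ N * Real.exp h ^ N := by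
      refine hDle.trans ?_
      have : ((N.factorial : ℕ) : ℝ) ≤ (N : ℝ) ^ N := by
        exact_mod_cast Nat.factorial_le_pow N
      gcongr
    have hDp : (0 : ℝ) < D := by exact_mod_cast hD
    have h2 := Real.log_le_log hDp h1
    rw [Real.log_mul (by positivity) (by positivity), Real.log_pow, Real.log_pow,
      Real.log_exp] at h2
    exact h2
  have hK : ((Nat.log 2 D : ℕ) : ℝ) * Real.log 2 ≤ Real.log D := by
    have h1 : 2 ^ Nat.log 2 D ≤ D := Nat.pow_log_le_self 2 (by omega)
    have h2 : ((2 : ℝ) ^ Nat.log 2 D) ≤ D := by exact_mod_cast h1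
    have h3 := Real.log_le_log (by positivity) h2
    rwa [Real.log_pow] at h3
  have hl2 : (1 / 2 : ℝ) < Real.log 2 := by
    have := Real.log_two_gt_d9
    linarith
  set K : ℝ := ((Nat.log 2 D : ℕ) : ℝ) with hKdef
  have hK0 : 0 ≤ K := Nat.cast_nonneg _
  set M : ℝ := (N : ℝ) * (h + Real.log N + 1) with hM
  have hK2 : K ≤ 2 * M := by
    have : K * (1 / 2) ≤ K * Real.log 2 := mul_le_mul_of_nonneg_left hl2.le hK0
    rw [hM]
    nlinarith
  have hM0 : 0 ≤ M := by positivity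
  have ht : (1 : ℝ) ≤ (n : ℝ) * d := by exact_mod_cast Nat.mul_pos hn hd1
  set t : ℝ := (n : ℝ) * d with htdef
  have hlt : 0 ≤ Real.log (t + 1) := Real.log_nonneg (by linarith)
  have hdeg : ((y j).natDegree : ℝ) ≤ t + 2 * t * K := by
    have := hyd j
    rw [htdef, hKdef]
    exact_mod_cast this
  have h1 : 2 * t * K ≤ 2 * t * (2 * M) := by gcongr
  have h2 : t * M ≤ t ^ 2 * M := by
    have : t ≤ t ^ 2 := by nlinarith
    gcongr
  have h3 : 0 ≤ t ^ 2 * M := by positivity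
  have h4 : 0 ≤ t ^ 2 * Real.log (t + 1) := by positivity
  have h5 : 3 * (n : ℝ) ^ 2 * (d : ℝ) ^ 2 *
      (2 * (2 * (N : ℝ) * (h + Real.log N + 1)) + Real.log (t + 1)) + t =
      12 * (t ^ 2 * M) + 3 * (t ^ 2 * Real.log (t + 1)) + t := by
    rw [hM, htdef]; ring
  rw [h5]
  linarith
end

section
/- Let F ∈ ℤ[x]^{n×m} be a matrix of full row rank n (over ℚ(x)) with d = deg(F) ≥ 1 and h = height(F), and let L ⊆ ℤ[x]^n be the ℤ[x]-submodule generated by the columns of F. Let I₁ = {a ∈ ℤ[x] : (a, 0, …, 0)ᵗ ∈ L}, which is an ideal of ℤ[x]. If I₁ ≠ 0 and {c₁,…,c_l} is a reduced Gröbner basis of I₁, then for every j, deg(c_j) ≤ n·d and height(c_j) ≤ 6n³d²(h + 1 + log(n²d)). -/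
open Polynomial

/-- A finite set `G` of nonzero polynomials in ℤ[x] with positive leading coefficients
is a Gröbner basis of an ideal `I ⊆ ℤ[x]` if `G ⊆ I`, `G` generates `I`, and for
every nonzero `f ∈ I` there is a `g ∈ G` with `deg g ≤ deg f` and `lc g ∣ lc f`. -/
def IsGroebnerBasis (G : Finset (Polynomial ℤ)) (I : Ideal (Polynomial ℤ)) : Prop :=
  (∀ g ∈ G, g ≠ 0 ∧ 0 < g.leadingCoeff) ∧
  (↑G : Set (Polynomial ℤ)) ⊆ (I : Set (Polynomial ℤ)) ∧
  Ideal.span (↑G : Set (Polynomial ℤ)) = I ∧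
  ∀ f ∈ I, f ≠ 0 → ∃ g ∈ G, g.natDegree ≤ Polynomial.natDegree f ∧
    g.leadingCoeff ∣ f.leadingCoeff

/-- A Gröbner basis `G` is reduced if moreover for all `g ≠ g'` in `G` and every
`k ≥ deg g'`, the coefficient of `x^k` in `g` lies in `[0, lc g')`. -/
def IsReducedGroebnerBasis (G : Finset (Polynomial ℤ)) (I : Ideal (Polynomial ℤ)) : Prop :=
  IsGroebnerBasis G I ∧
  ∀ g ∈ G, ∀ g' ∈ G, g ≠ g' → ∀ k : ℕ, g'.natDegree ≤ k →
    0 ≤ g.coeff k ∧ g.coeff k < g'.leadingCoeff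


namespace GHNF

/-- Vectors of polynomials of degree `< N`. -/
noncomputable def polyVec (R : Type*) [CommRing R] (ι : Type*) (N : ℕ) : Submodule R (ι → R[X]) :=
  Submodule.pi Set.univ (fun _ => degreeLT R N)

/-- Multiplication by `X`. -/
noncomputable def mulX (R : Type*) [CommRing R] (ι : Type*) : (ι → R[X]) →ₗ[R] (ι → R[X]) :=
  DistribSMul.toLinearMap R (ι → R[X]) (X : R[X])

theorem mulX_apply {R : Type*} [CommRing R] {ι : Type*} (v : ι → R[X]) (i : ι) :
    mulX R ι v i = X * v i := rfl

theorem mulX_injective (R : Type*) [CommRing R] [IsDomain R] (ι : Type*) :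
    Function.Injective (mulX R ι) := by
  intro v w hvw
  funext i
  have := congrFun hvw i
  rw [mulX_apply, mulX_apply] at this
  exact mul_left_cancel₀ X_ne_zero this

theorem mem_polyVec {R : Type*} [CommRing R] {ι : Type*} {N : ℕ} {v : ι → R[X]} :
    v ∈ polyVec R ι N ↔ ∀ i, ∀ k, N ≤ k → (v i).coeff k = 0 := by
  simp only [polyVec, Submodule.mem_pi, Set.mem_univ, true_implies, mem_degreeLT]
  refine forall_congr' fun i => ?_
  exact Polynomial.degree_lt_iff_coeff_zero _ _

noncomputable def polyVecEquiv (R : Type*) [CommRing R] (ι : Type*) (N : ℕ) :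
    polyVec R ι N ≃ₗ[R] (ι → Fin N → R) :=
  LinearEquiv.trans
    { toFun := fun v i => ⟨v.1 i, v.2 i (Set.mem_univ i)⟩
      invFun := fun w => ⟨fun i => (w i).1, fun i _ => (w i).2⟩
      map_add' := fun _ _ => rfl
      map_smul' := fun _ _ => rfl
      left_inv := fun _ => rfl
      right_inv := fun _ => rfl : polyVec R ι N ≃ₗ[R] (ι → degreeLT R N) }
    (LinearEquiv.piCongrRight (fun _ => degreeLTEquiv R N))

instance polyVec_finite (R : Type*) [CommRing R] (ι : Type*) [Finite ι] (N : ℕ) :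
    Module.Finite R (polyVec R ι N) :=
  Module.Finite.equiv (polyVecEquiv R ι N).symm

theorem finrank_polyVec (R : Type*) [CommRing R] [Nontrivial R] (ι : Type*) [Fintype ι] (N : ℕ) :
    Module.finrank R (polyVec R ι N) = Fintype.card ι * N := by
  rw [(polyVecEquiv R ι N).finrank_eq]
  simp [Module.finrank_pi_fintype]

theorem finite_of_le {R : Type*} [CommRing R] [IsNoetherianRing R] {M : Type*} [AddCommGroup M]
    [Module R M] {S T : Submodule R M} [Module.Finite R T] (hST : S ≤ T) : Module.Finite R S := by
  exact Module.Finite.of_injective (Submodule.inclusion hST) (Submodule.inclusion_injective hST)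

theorem finrank_sup_inf {R : Type*} [CommRing R] [IsDomain R] [IsNoetherianRing R]
    {M : Type*} [AddCommGroup M] [Module R M] (S T : Submodule R M)
    [Module.Finite R S] [Module.Finite R T] :
    Module.finrank R ↥(S ⊔ T) + Module.finrank R ↥(S ⊓ T) =
      Module.finrank R S + Module.finrank R T := by
  have h := Submodule.rank_sup_add_rank_inf_eq S T
  have : Module.Finite R ↥(S ⊓ T) := finite_of_le inf_le_left
  rw [← Module.finrank_eq_rank, ← Module.finrank_eq_rank, ← Module.finrank_eq_rank,
    ← Module.finrank_eq_rank] at h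
  exact_mod_cast h

theorem mulX_mem {R : Type*} [CommRing R] {ι : Type*} {N : ℕ} {v : ι → R[X]}
    (hv : v ∈ polyVec R ι N) : mulX R ι v ∈ polyVec R ι (N + 1) := by
  rw [mem_polyVec] at *
  intro i k hk
  obtain ⟨k, rfl⟩ : ∃ j, k = j + 1 := ⟨k - 1, by omega⟩
  rw [mulX_apply, coeff_X_mul]
  exact hv i k (by omega)

theorem mulX_mem_iff {R : Type*} [CommRing R] {ι : Type*} {N : ℕ} {v : ι → R[X]}
    (hv : mulX R ι v ∈ polyVec R ι (N + 1)) : v ∈ polyVec R ι N := by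
  rw [mem_polyVec] at *
  intro i k hk
  have := hv i (k + 1) (by omega)
  rwa [mulX_apply, coeff_X_mul] at this

/-- Growth lemma. -/
theorem growth {R : Type*} [CommRing R] [IsDomain R] [IsNoetherianRing R]
    {ι : Type*} [Finite ι] (N : ℕ) : ∀ (V : Submodule R (ι → R[X])), V ≤ polyVec R ι N →
    ∀ δ : ℕ, Module.finrank R ↥(V ⊔ V.map (mulX R ι)) ≤ Module.finrank R V + δ →
    Module.finrank R V ≤ N * δ := by
  induction N with
  | zero =>
    intro V hV δ _
    have : V = ⊥ := by
      rw [eq_bot_iff]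
      intro v hv
      have := mem_polyVec.1 (hV hv)
      rw [Submodule.mem_bot]
      funext i
      ext k
      simpa using this i k (Nat.zero_le _)
    subst this
    simp
  | succ N ih =>
    intro V hV δ hδ
    have : Module.Finite R V := finite_of_le hV
    set V' : Submodule R (ι → R[X]) := V ⊓ V.comap (mulX R ι) with hV'
    have hV'V : V' ≤ V := inf_le_left
    have : Module.Finite R V' := finite_of_le hV'V
    have hfr : ∀ W : Submodule R (ι → R[X]),
        Module.finrank R (W.map (mulX R ι)) = Module.finrank R W := fun W =>
      (Submodule.equivMapOfInjective _ (mulX_injective R ι) W).finrank_eq.symm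
    have hinf : V ⊓ V.map (mulX R ι) = V'.map (mulX R ι) := by
      ext v
      constructor
      · rintro ⟨h1, w, hw, rfl⟩
        exact ⟨w, ⟨hw, h1⟩, rfl⟩
      · rintro ⟨w, ⟨hw, h1⟩, rfl⟩
        exact ⟨h1, w, hw, rfl⟩
    have h1 := finrank_sup_inf V (V.map (mulX R ι))
    rw [hinf, hfr, hfr] at h1
    have hle : V' ⊔ V'.map (mulX R ι) ≤ V := by
      refine sup_le hV'V ?_
      rintro _ ⟨w, hw, rfl⟩
      exact hw.2
    have h2 : Module.finrank R ↥(V' ⊔ V'.map (mulX R ι)) ≤ Module.finrank R V :=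
      Submodule.finrank_mono hle
    have h3 := ih V' (fun v hv => mulX_mem_iff (hV hv.2)) δ (by omega)
    rw [Nat.succ_mul]
    omega


theorem eq_top_of_primes {M : Type*} [AddCommGroup M] [Module.Finite ℤ M] (S : Submodule ℤ M)
    (h : ∀ p : ℕ, p.Prime → ∀ v : M, ∃ s ∈ S, ∃ w : M, v = s + (p : ℤ) • w) : S = ⊤ := by
  by_contra hne
  obtain ⟨C, hC, hSC⟩ := (eq_top_or_exists_le_coatom S).resolve_left hne
  have hsimple : IsSimpleModule ℤ (M ⧸ C) := isSimpleModule_iff_isCoatom.2 hC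
  obtain ⟨I, hI, ⟨e⟩⟩ := isSimpleModule_iff_quot_maximal.1 hsimple
  have hIne : I ≠ ⊥ := by
    rintro rfl
    exact Int.not_isField ((Ring.isField_iff_maximal_bot (R := ℤ)).2 hI)
  have hp := Submodule.IsPrincipal.prime_generator_of_isPrime I hIne
  set q := Submodule.IsPrincipal.generator I with hq
  have hqI : q ∈ I := Submodule.IsPrincipal.generator_mem I
  have hpp : q.natAbs.Prime := Int.prime_iff_natAbs_prime.1 hp
  have hpI : (q.natAbs : ℤ) ∈ I := by
    rcases Int.natAbs_eq q with h1 | h1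
    · rwa [← h1]
    · have : (q.natAbs : ℤ) = -q := by omega
      rw [this]; exact I.neg_mem hqI
  have hann : ∀ w : M ⧸ C, (q.natAbs : ℤ) • w = 0 := by
    intro w
    apply e.injective
    rw [map_smul, map_zero]
    obtain ⟨z, hz⟩ := Ideal.Quotient.mk_surjective (e w)
    rw [← hz]
    change (q.natAbs : ℤ) • Submodule.Quotient.mk z = 0
    rw [← Submodule.Quotient.mk_smul, Submodule.Quotient.mk_eq_zero]
    exact I.mul_mem_right z hpI
  apply hC.1
  rw [eq_top_iff]
  intro v _
  obtain ⟨s, hs, w, rfl⟩ := h _ hpp v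
  refine C.add_mem (hSC hs) ?_
  have := hann (Submodule.Quotient.mk w)
  rwa [← Submodule.Quotient.mk_smul, Submodule.Quotient.mk_eq_zero] at this

/-- Extension of a vector along a choice of columns. -/
def extVec {R : Type*} [CommRing R] {ι κ : Type*} [Fintype ι] [DecidableEq κ] (f : ι → κ)
    (v : ι → R) : κ → R := fun j => ∑ i, if f i = j then v i else 0

theorem mulVec_extVec {R : Type*} [CommRing R] {ι κ ν : Type*} [Fintype ι] [Fintype κ]
    [DecidableEq κ] (A : Matrix ν κ R) (f : ι → κ) (v : ι → R) :
    A.mulVec (extVec f v) = (A.submatrix id f).mulVec v := by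
  funext a
  simp only [Matrix.mulVec, dotProduct, extVec, Finset.mul_sum, Matrix.submatrix_apply, id]
  rw [Finset.sum_comm]
  simp

/-- kernel in bounded degree -/
noncomputable def kerN {r m : ℕ} (A : Matrix (Fin r) (Fin m) ℤ[X]) (N : ℕ) :
    Submodule ℤ (Fin m → ℤ[X]) :=
  polyVec ℤ (Fin m) N ⊓ (LinearMap.ker A.mulVecLin).restrictScalars ℤ

theorem mem_kerN {r m : ℕ} {A : Matrix (Fin r) (Fin m) ℤ[X]} {N : ℕ} {v : Fin m → ℤ[X]} :
    v ∈ kerN A N ↔ v ∈ polyVec ℤ (Fin m) N ∧ A.mulVec v = 0 := by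
  simp [kerN]

instance kerN_finite {r m : ℕ} (A : Matrix (Fin r) (Fin m) ℤ[X]) (N : ℕ) :
    Module.Finite ℤ (kerN A N) := finite_of_le (inf_le_left : kerN A N ≤ polyVec ℤ (Fin m) N)

noncomputable def imN {r m : ℕ} (A : Matrix (Fin r) (Fin m) ℤ[X]) (N : ℕ) :
    Submodule ℤ (Fin r → ℤ[X]) :=
  (polyVec ℤ (Fin m) N).map (A.mulVecLin.restrictScalars ℤ)

theorem finrank_kerN_add {r m : ℕ} (A : Matrix (Fin r) (Fin m) ℤ[X]) (N : ℕ) :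
    Module.finrank ℤ (imN A N) + Module.finrank ℤ (kerN A N) = m * N := by
  set Φ := (A.mulVecLin.restrictScalars ℤ).domRestrict (polyVec ℤ (Fin m) N) with hΦ
  have h := LinearMap.rank_range_add_rank_ker Φ
  have h1 : LinearMap.range Φ = imN A N := by
    rw [hΦ, LinearMap.range_domRestrict, imN]
  have h2 : kerN A N = (LinearMap.ker Φ).map (polyVec ℤ (Fin m) N).subtype := by
    ext v
    simp [mem_kerN, hΦ, Submodule.mem_map, and_comm]
  have h3 : Module.finrank ℤ (kerN A N) = Module.finrank ℤ (LinearMap.ker Φ) := by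
    rw [h2, Submodule.finrank_map_subtype_eq]
  rw [h3, ← h1]
  rw [← Module.finrank_eq_rank, ← Module.finrank_eq_rank, ← Module.finrank_eq_rank,
    finrank_polyVec, Fintype.card_fin] at h
  exact_mod_cast h

theorem mulVec_mem_polyVec {R : Type*} [CommRing R] {ι κ : Type*} [Fintype κ]
    (A : Matrix ι κ R[X]) (d : ℕ) (hA : ∀ i j, (A i j).natDegree ≤ d) {N : ℕ} {v : κ → R[X]}
    (hv : v ∈ polyVec R κ N) : A.mulVec v ∈ polyVec R ι (N + d) := by
  rw [mem_polyVec] at *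
  intro i k hk
  simp only [Matrix.mulVec, dotProduct, finsetSum_coeff]
  refine Finset.sum_eq_zero fun j _ => ?_
  rw [coeff_mul]
  refine Finset.sum_eq_zero fun x hx => ?_
  rw [Finset.HasAntidiagonal.mem_antidiagonal] at hx
  by_cases h : N ≤ x.2
  · rw [hv j _ h, mul_zero]
  · rw [coeff_eq_zero_of_natDegree_lt (lt_of_le_of_lt (hA i j) (by omega)), zero_mul]

theorem mulVec_mulX {R : Type*} [CommRing R] {ι κ : Type*} [Fintype κ]
    (A : Matrix ι κ R[X]) (v : κ → R[X]) : A.mulVec (mulX R κ v) = mulX R ι (A.mulVec v) := by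
  change A.mulVec ((X : R[X]) • v) = (X : R[X]) • A.mulVec v
  exact Matrix.mulVec_smul A X v

theorem imN_le {r m : ℕ} (A : Matrix (Fin r) (Fin m) ℤ[X]) (d : ℕ)
    (hA : ∀ i j, (A i j).natDegree ≤ d) (N : ℕ) : imN A N ≤ polyVec ℤ (Fin r) (N + d) := by
  rintro _ ⟨v, hv, rfl⟩
  exact mulVec_mem_polyVec A d hA hv

theorem finrank_imN_ge {r m : ℕ} (A : Matrix (Fin r) (Fin m) ℤ[X])
    (f : Fin r → Fin m) (hf : (A.submatrix id f).det ≠ 0) (N : ℕ) :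
    r * N ≤ Module.finrank ℤ (imN A N) := by
  have hinj : Function.Injective
      ((A.submatrix id f).mulVecLin.restrictScalars ℤ : (Fin r → ℤ[X]) →ₗ[ℤ] (Fin r → ℤ[X])) := by
    rw [← LinearMap.ker_eq_bot, eq_bot_iff]
    intro v hv
    by_contra hne
    exact hf (Matrix.exists_mulVec_eq_zero_iff.1 ⟨v, hne, hv⟩)
  have h1 : (polyVec ℤ (Fin r) N).map ((A.submatrix id f).mulVecLin.restrictScalars ℤ) ≤
      imN A N := by
    rintro _ ⟨v, hv, rfl⟩
    refine ⟨extVec f v, ?_, mulVec_extVec A f v⟩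
    have hv' := mem_polyVec.1 hv
    refine mem_polyVec.2 fun j k hk => ?_
    simp only [extVec, finsetSum_coeff]
    refine Finset.sum_eq_zero fun i _ => ?_
    split_ifs
    · exact hv' i k hk
    · simp
  have : Module.Finite ℤ (imN A N) := by unfold imN; infer_instance
  have h2 := Submodule.finrank_mono h1
  rwa [← (Submodule.equivMapOfInjective _ hinj (polyVec ℤ (Fin r) N)).finrank_eq,
    finrank_polyVec, Fintype.card_fin] at h2

theorem finrank_imN_succ {r m : ℕ} (A : Matrix (Fin r) (Fin m) ℤ[X]) (d : ℕ)
    (hA : ∀ i j, (A i j).natDegree ≤ d)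
    (f : Fin r → Fin m) (hf : (A.submatrix id f).det ≠ 0) (N : ℕ) (hN : r * d + 1 ≤ N) :
    Module.finrank ℤ (imN A N) + r ≤ Module.finrank ℤ (imN A (N + 1)) := by
  have hfin : ∀ N, Module.Finite ℤ (imN A N) := fun N => by unfold imN; infer_instance
  have hle : imN A N ⊔ (imN A N).map (mulX ℤ (Fin r)) ≤ imN A (N + 1) := by
    refine sup_le ?_ ?_
    · rintro _ ⟨v, hv, rfl⟩
      refine ⟨v, ?_, rfl⟩
      have hv' := mem_polyVec.1 hv
      exact mem_polyVec.2 fun i k hk => hv' i k (by omega)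
    · rintro _ ⟨_, ⟨v, hv, rfl⟩, rfl⟩
      exact ⟨mulX ℤ _ v, mulX_mem hv, mulVec_mulX A v⟩
  have h1 := Submodule.finrank_mono hle
  by_contra hlt
  have : Module.Finite ℤ ↥(imN A N ⊔ (imN A N).map (mulX ℤ (Fin r))) := finite_of_le hle
  have h0 : Module.finrank ℤ (imN A N) ≤
      Module.finrank ℤ ↥(imN A N ⊔ (imN A N).map (mulX ℤ (Fin r))) :=
    Submodule.finrank_mono le_sup_left
  obtain ⟨s, rfl⟩ : ∃ s, r = s + 1 := ⟨r - 1, by omega⟩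
  have h2 := growth (N + d) (imN A N) (imN_le A d hA N) s (by omega)
  have h3 := finrank_imN_ge A f hf N
  nlinarith

theorem finrank_kerN_succ {r m : ℕ} (A : Matrix (Fin r) (Fin m) ℤ[X]) (d : ℕ)
    (hA : ∀ i j, (A i j).natDegree ≤ d)
    (f : Fin r → Fin m) (hf : (A.submatrix id f).det ≠ 0) (N : ℕ) (hN : r * d + 1 ≤ N) :
    Module.finrank ℤ (kerN A (N + 1)) + r ≤ Module.finrank ℤ (kerN A N) + m := by
  have h1 := finrank_imN_succ A d hA f hf N hN
  have h2 := finrank_kerN_add A N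
  have h3 := finrank_kerN_add A (N + 1)
  rw [Nat.mul_succ] at h3
  omega

theorem finrank_kerN_ge {r m : ℕ} (A : Matrix (Fin r) (Fin m) ℤ[X]) (d : ℕ)
    (hA : ∀ i j, (A i j).natDegree ≤ d) (N : ℕ) :
    m * N ≤ Module.finrank ℤ (kerN A N) + r * (N + d) := by
  have h2 := finrank_kerN_add A N
  have h1 := Submodule.finrank_mono (imN_le A d hA N)
  rw [finrank_polyVec, Fintype.card_fin] at h1
  omega

/-- reduction mod `p` -/
noncomputable def red (p m : ℕ) : (Fin m → ℤ[X]) →+ (Fin m → (ZMod p)[X]) where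
  toFun v := fun i => (v i).map (Int.castRingHom (ZMod p))
  map_zero' := by funext i; simp
  map_add' v w := by funext i; simp

theorem red_apply (p m : ℕ) (v : Fin m → ℤ[X]) (i : Fin m) :
    red p m v i = (v i).map (Int.castRingHom (ZMod p)) := rfl

theorem red_smul (p m : ℕ) (z : ℤ) (v : Fin m → ℤ[X]) :
    red p m (z • v) = (z : ZMod p) • red p m v := by
  funext i
  ext k
  simp [red_apply]

theorem red_mulX (p m : ℕ) (v : Fin m → ℤ[X]) :
    red p m (mulX ℤ _ v) = mulX (ZMod p) _ (red p m v) := by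
  funext i
  simp [red_apply, mulX_apply]

theorem red_eq_zero (p m : ℕ) (v : Fin m → ℤ[X]) (hv : red p m v = 0) :
    ∃ w, v = (p : ℤ) • w := by
  have h : ∀ i, ∃ q : ℤ[X], v i = C (p : ℤ) * q := by
    intro i
    have : C (p : ℤ) ∣ v i := by
      rw [C_dvd_iff_dvd_coeff]
      intro k
      have h1 : (red p m v i).coeff k = 0 := by rw [hv]; simp
      rw [red_apply, coeff_map] at h1
      exact (ZMod.intCast_zmod_eq_zero_iff_dvd _ p).1 h1
    exact this
  choose w hw using h
  refine ⟨w, funext fun i => ?_⟩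
  rw [hw i, Pi.smul_apply, ← smul_eq_C_mul]

noncomputable def redN {r m : ℕ} (A : Matrix (Fin r) (Fin m) ℤ[X]) (p N : ℕ) :
    Submodule (ZMod p) (Fin m → (ZMod p)[X]) :=
  Submodule.span (ZMod p) (red p m '' (kerN A N))

theorem mem_redN {r m : ℕ} (A : Matrix (Fin r) (Fin m) ℤ[X]) (p N : ℕ)
    (w : Fin m → (ZMod p)[X]) : w ∈ redN A p N ↔ ∃ v ∈ kerN A N, red p m v = w := by
  constructor
  · intro hw
    refine Submodule.span_induction (p := fun w _ => ∃ v ∈ kerN A N, red p m v = w)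
      ?_ ?_ ?_ ?_ hw
    · rintro _ ⟨v, hv, rfl⟩
      exact ⟨v, hv, rfl⟩
    · exact ⟨0, zero_mem _, map_zero _⟩
    · rintro _ _ _ _ ⟨v, hv, rfl⟩ ⟨w, hw, rfl⟩
      exact ⟨v + w, add_mem hv hw, map_add _ _ _⟩
    · rintro a _ _ ⟨v, hv, rfl⟩
      obtain ⟨z, rfl⟩ := ZMod.intCast_surjective a
      exact ⟨z • v, Submodule.smul_mem _ _ hv, red_smul _ _ _ _⟩
  · rintro ⟨v, hv, rfl⟩
    exact Submodule.subset_span ⟨v, hv, rfl⟩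

theorem kerN_saturated {r m : ℕ} (A : Matrix (Fin r) (Fin m) ℤ[X]) (p : ℕ) (hp : p ≠ 0) (N : ℕ)
    (w : Fin m → ℤ[X]) (hw : (p : ℤ) • w ∈ kerN A N) : w ∈ kerN A N := by
  have hp' : (p : ℤ) ≠ 0 := by exact_mod_cast hp
  rw [mem_kerN] at *
  constructor
  · have h1 := mem_polyVec.1 hw.1
    refine mem_polyVec.2 fun i k hk => ?_
    have := h1 i k hk
    rw [Pi.smul_apply, coeff_smul, smul_eq_mul] at this
    exact (mul_eq_zero.1 this).resolve_left hp'
  · have h1 := hw.2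
    rw [Matrix.mulVec_smul] at h1
    exact (smul_eq_zero.1 h1).resolve_left hp'

theorem finrank_redN {r m : ℕ} (A : Matrix (Fin r) (Fin m) ℤ[X]) (p N : ℕ) [hp : Fact p.Prime] :
    Module.finrank (ZMod p) (redN A p N) = Module.finrank ℤ (kerN A N) := by
  have hp0 : p ≠ 0 := hp.out.ne_zero
  set b := Module.finBasis ℤ (kerN A N) with hb
  have hsum : ∀ (c : Fin (Module.finrank ℤ (kerN A N)) → ℤ),
      red p m (((∑ i, c i • b i : kerN A N) : Fin m → ℤ[X])) =
        ∑ i, (c i : ZMod p) • red p m (b i) := by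
    intro c
    rw [Submodule.coe_sum, map_sum]
    refine Finset.sum_congr rfl fun i _ => ?_
    rw [Submodule.coe_smul, red_smul]
  have hspan : redN A p N = Submodule.span (ZMod p) (Set.range fun i => red p m (b i)) := by
    apply le_antisymm
    · refine Submodule.span_le.2 ?_
      rintro _ ⟨v, hv, rfl⟩
      have h1 := b.sum_repr ⟨v, hv⟩
      have h2 := hsum (fun i => b.repr ⟨v, hv⟩ i)
      rw [h1] at h2
      change red p m v = _ at h2
      rw [h2]
      exact Submodule.sum_mem _ fun i _ => Submodule.smul_mem _ _
        (Submodule.subset_span ⟨i, rfl⟩)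
    · refine Submodule.span_le.2 ?_
      rintro _ ⟨i, rfl⟩
      exact Submodule.subset_span ⟨b i, (b i).2, rfl⟩
  have hli : LinearIndependent (ZMod p) (fun i => red p m (b i)) := by
    rw [Fintype.linearIndependent_iff]
    intro g hg i
    have hlift : ∀ i, ∃ z : ℤ, (z : ZMod p) = g i := fun i => ZMod.intCast_surjective (g i)
    choose c hc using hlift
    have h1 := hsum c
    simp only [hc] at h1
    rw [hg] at h1
    obtain ⟨w, hw⟩ := red_eq_zero p m _ h1
    have hwk : w ∈ kerN A N := kerN_saturated A p hp0 N w (by rw [← hw]; exact Subtype.coe_prop _)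
    have h2 : (∑ i, c i • b i : kerN A N) = (p : ℤ) • (⟨w, hwk⟩ : kerN A N) := Subtype.ext hw
    have h3 := congrArg (fun v => b.repr v i) h2
    simp only [b.repr_sum_self, map_smul, Finsupp.smul_apply, smul_eq_mul] at h3
    rw [← hc i, h3]
    simp
  rw [hspan, finrank_span_eq_card hli, Fintype.card_fin]

/-- Key step: the kernel is generated in low degree. -/
theorem kerN_succ {r m : ℕ} (A : Matrix (Fin r) (Fin m) ℤ[X]) (d : ℕ)
    (hA : ∀ i j, (A i j).natDegree ≤ d)
    (f : Fin r → Fin m) (hf : (A.submatrix id f).det ≠ 0) (N : ℕ) (hN : r * d + 1 ≤ N) :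
    kerN A (N + 1) ≤ kerN A N ⊔ (kerN A N).map (mulX ℤ (Fin m)) := by
  have hle1 : kerN A N ≤ kerN A (N + 1) := by
    intro v hv
    rw [mem_kerN] at *
    refine ⟨?_, hv.2⟩
    have hv' := mem_polyVec.1 hv.1
    exact mem_polyVec.2 fun i k hk => hv' i k (by omega)
  have hX : ∀ v ∈ kerN A N, mulX ℤ (Fin m) v ∈ kerN A (N + 1) := by
    intro v hv
    rw [mem_kerN] at *
    refine ⟨mulX_mem hv.1, ?_⟩
    rw [mulVec_mulX, hv.2, map_zero]
  have hle2 : (kerN A N).map (mulX ℤ (Fin m)) ≤ kerN A (N + 1) := by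
    rintro _ ⟨v, hv, rfl⟩
    exact hX v hv
  set S := kerN A N ⊔ (kerN A N).map (mulX ℤ (Fin m)) with hS
  have hSle : S ≤ kerN A (N + 1) := sup_le hle1 hle2
  suffices h : S.submoduleOf (kerN A (N + 1)) = ⊤ by
    exact Submodule.submoduleOf_eq_top.1 h
  refine eq_top_of_primes _ fun p hp v => ?_
  have : Fact p.Prime := ⟨hp⟩
  have hredle : redN A p N ⊔ (redN A p N).map (mulX (ZMod p) (Fin m)) ≤ redN A p (N + 1) := by
    refine sup_le ?_ ?_
    · intro w hw
      obtain ⟨v, hv, rfl⟩ := (mem_redN A p N w).1 hw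
      exact (mem_redN A p _ _).2 ⟨v, hle1 hv, rfl⟩
    · rintro _ ⟨w, hw, rfl⟩
      obtain ⟨v, hv, rfl⟩ := (mem_redN A p N w).1 hw
      exact (mem_redN A p _ _).2 ⟨mulX ℤ _ v, hX v hv, red_mulX p m v⟩
  have hredpoly : ∀ N, redN A p N ≤ polyVec (ZMod p) (Fin m) N := by
    intro N w hw
    obtain ⟨v, hv, rfl⟩ := (mem_redN A p N w).1 hw
    have hv' := mem_polyVec.1 (mem_kerN.1 hv).1
    refine mem_polyVec.2 fun i k hk => ?_
    rw [red_apply, coeff_map, hv' i k hk, map_zero]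
  have hfin : Module.Finite (ZMod p) (redN A p (N + 1)) := finite_of_le (hredpoly (N + 1))
  have hk1 := finrank_kerN_succ A d hA f hf N hN
  have hk2 := finrank_kerN_ge A d hA N
  have heq : redN A p N ⊔ (redN A p N).map (mulX (ZMod p) (Fin m)) = redN A p (N + 1) := by
    refine Submodule.eq_of_le_of_finrank_le hredle ?_
    by_contra hlt
    rw [finrank_redN] at hlt
    have hfN := finrank_redN A p N
    have : Module.Finite (ZMod p)
      ↥(redN A p N ⊔ (redN A p N).map (mulX (ZMod p) (Fin m))) := finite_of_le hredle
    have h0 : Module.finrank (ZMod p) (redN A p N) ≤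
        Module.finrank (ZMod p) ↥(redN A p N ⊔ (redN A p N).map (mulX (ZMod p) (Fin m))) :=
      Submodule.finrank_mono le_sup_left
    obtain ⟨s, hs⟩ : ∃ s, m = r + s + 1 := ⟨m - r - 1, by omega⟩
    have h2 := growth N (redN A p N) (hredpoly N) s (by omega)
    rw [hfN] at h2
    subst hs
    nlinarith
  have hv1 : red p m v ∈ redN A p (N + 1) := (mem_redN A p _ _).2 ⟨v, v.2, rfl⟩
  rw [← heq, Submodule.mem_sup] at hv1
  obtain ⟨y, hy, _, ⟨z, hz, rfl⟩, hyz⟩ := hv1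
  obtain ⟨y, hy', rfl⟩ := (mem_redN A p N _).1 hy
  obtain ⟨z, hz', rfl⟩ := (mem_redN A p N _).1 hz
  have hsS : y + mulX ℤ _ z ∈ S :=
    Submodule.add_mem_sup hy' (Submodule.mem_map_of_mem hz')
  have h0 : red p m ((v : Fin m → ℤ[X]) - (y + mulX ℤ _ z)) = 0 := by
    rw [map_sub, map_add, red_mulX, hyz, sub_self]
  obtain ⟨w, hw⟩ := red_eq_zero p m _ h0
  have hwk : w ∈ kerN A (N + 1) := kerN_saturated A p hp.ne_zero _ w (by
    rw [← hw]; exact sub_mem v.2 (hSle hsS))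
  refine ⟨⟨y + mulX ℤ _ z, hSle hsS⟩, hsS, ⟨w, hwk⟩, Subtype.ext ?_⟩
  change (v : Fin m → ℤ[X]) = (y + mulX ℤ _ z) + (p : ℤ) • w
  rw [← hw]; abel

/-- The chain `W + xW + ... + x^i W`. -/
noncomputable def chainW (W : Submodule ℤ ℤ[X]) : ℕ → Submodule ℤ ℤ[X]
  | 0 => W
  | i + 1 => chainW W i ⊔ W.map (LinearMap.mulLeft ℤ (X ^ (i + 1) : ℤ[X]))

theorem chainW_mono_succ (W : Submodule ℤ ℤ[X]) (i : ℕ) : chainW W i ≤ chainW W (i + 1) :=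
  le_sup_left

theorem X_mul_mem_chainW (W : Submodule ℤ ℤ[X]) (i : ℕ) :
    ∀ a ∈ chainW W i, X * a ∈ chainW W (i + 1) := by
  induction i with
  | zero =>
    intro a ha
    refine Submodule.mem_sup_right ⟨a, ha, ?_⟩
    simp
  | succ i ih =>
    intro a ha
    obtain ⟨y, hy, _, ⟨z, hz, rfl⟩, rfl⟩ := Submodule.mem_sup.1 ha
    rw [mul_add]
    refine Submodule.add_mem_sup (ih y hy) ⟨z, hz, ?_⟩
    simp only [LinearMap.mulLeft_apply]
    ring

theorem chainW_coeff (W : Submodule ℤ ℤ[X]) (D : ℕ)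
    (hW : ∀ a ∈ W, ∀ k, D < k → a.coeff k = 0) (i : ℕ) :
    ∀ a ∈ chainW W i, ∀ k, D + i < k → a.coeff k = 0 := by
  induction i with
  | zero => exact fun a ha k hk => hW a ha k hk
  | succ i ih =>
    intro a ha k hk
    obtain ⟨y, hy, _, ⟨z, hz, rfl⟩, rfl⟩ := Submodule.mem_sup.1 ha
    rw [coeff_add, ih y hy k (by omega), LinearMap.mulLeft_apply, coeff_X_pow_mul',
      if_pos (by omega), hW z hz _ (by omega), add_zero]

theorem degree_drop (I : Ideal ℤ[X]) (D : ℕ) (W : Submodule ℤ ℤ[X])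
    (hW : ∀ a, a ∈ W ↔ a ∈ I ∧ ∀ k, D < k → a.coeff k = 0) (N : ℕ) :
    ∀ a ∈ chainW W N, a.natDegree ≤ D ∨
      ∃ b ∈ I, b ≠ 0 ∧ b.natDegree < a.natDegree ∧ b.leadingCoeff = a.leadingCoeff := by
  have hWc : ∀ a ∈ W, ∀ k, D < k → a.coeff k = 0 := fun a ha => ((hW a).1 ha).2
  induction N with
  | zero =>
    intro a ha
    left
    exact natDegree_le_iff_coeff_eq_zero.2 fun k hk => hWc a ha k hk
  | succ N ih =>
    intro a ha
    obtain ⟨y, hy, _, ⟨z, hz, rfl⟩, rfl⟩ := Submodule.mem_sup.1 ha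
    rw [LinearMap.mulLeft_apply] at *
    by_cases hzD : z.coeff D = 0
    · apply ih
      refine add_mem hy ?_
      have hXz : X * z ∈ W := by
        rw [SetLike.mem_coe, hW] at hz
        rw [hW]
        refine ⟨I.mul_mem_left _ hz.1, fun k hk => ?_⟩
        obtain ⟨k, rfl⟩ : ∃ j, k = j + 1 := ⟨k - 1, by omega⟩
        rw [coeff_X_mul]
        rcases Nat.lt_or_ge D k with h | h
        · exact hz.2 k h
        · rw [show k = D by omega, hzD]
      have heq : (X : ℤ[X]) ^ (N + 1) * z = X ^ N * (X * z) := by ring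
      rw [heq]
      cases N with
      | zero => rw [pow_zero, one_mul]; exact hXz
      | succ N => exact Submodule.mem_sup_right ⟨X * z, hXz, rfl⟩
    · right
      have hz0 : z ≠ 0 := by rintro rfl; simp at hzD
      have hzdeg : z.natDegree = D := by
        apply le_antisymm
        · exact natDegree_le_iff_coeff_eq_zero.2 fun k hk => hWc z hz k hk
        · exact le_natDegree_of_ne_zero hzD
      have hc : (y + X ^ (N + 1) * z).coeff (D + (N + 1)) = z.coeff D := by
        rw [coeff_add, chainW_coeff W D hWc N y hy _ (by omega), coeff_X_pow_mul, zero_add]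
      have hdeg : (y + X ^ (N + 1) * z).natDegree = D + (N + 1) := by
        apply le_antisymm
        · exact natDegree_le_iff_coeff_eq_zero.2 fun k hk =>
            chainW_coeff W D hWc (N + 1) _ ha k (by omega)
        · exact le_natDegree_of_ne_zero (by rw [hc]; exact hzD)
      refine ⟨X ^ N * z, I.mul_mem_left _ ((hW z).1 hz).1, mul_ne_zero (by simp) hz0, ?_, ?_⟩
      · rw [hdeg, natDegree_X_pow_mul _ hz0, hzdeg]; omega
      · rw [leadingCoeff_mul, leadingCoeff_X_pow, one_mul, leadingCoeff, leadingCoeff, hdeg, hc,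
          hzdeg]

theorem low_degree {r m : ℕ} (F : Matrix (Fin (r + 1)) (Fin m) ℤ[X]) (d : ℕ)
    (hF : ∀ i j, (F i j).natDegree ≤ d)
    (f : Fin (r + 1) → Fin m) (hf : (F.submatrix id f).det ≠ 0) (I : Ideal ℤ[X])
    (hI : ∀ a, a ∈ I ↔ ∃ u, F.mulVec u = Pi.single 0 a) (a : ℤ[X]) (ha : a ∈ I) :
    a.natDegree ≤ (r + 1) * d ∨
      ∃ b ∈ I, b ≠ 0 ∧ b.natDegree < a.natDegree ∧ b.leadingCoeff = a.leadingCoeff := by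
  set A : Matrix (Fin r) (Fin m) ℤ[X] := F.submatrix Fin.succ id with hA
  have hAd : ∀ i j, (A i j).natDegree ≤ d := fun i j => hF _ _
  obtain ⟨g, hg⟩ : ∃ g : Fin r → Fin m, (A.submatrix id g).det ≠ 0 := by
    by_contra hcon
    push Not at hcon
    apply hf
    rw [Matrix.det_succ_row_zero]
    refine Finset.sum_eq_zero fun j _ => ?_
    have := hcon (f ∘ j.succAbove)
    rw [show (F.submatrix id f).submatrix Fin.succ j.succAbove =
      A.submatrix id (f ∘ j.succAbove) from rfl, this, mul_zero]
  set D := (r + 1) * d with hD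
  let W : Submodule ℤ ℤ[X] := I.restrictScalars ℤ ⊓ degreeLT ℤ (D + 1)
  have hW : ∀ a, a ∈ W ↔ a ∈ I ∧ ∀ k, D < k → a.coeff k = 0 := by
    intro a
    simp only [W, Submodule.mem_inf, Submodule.restrictScalars_mem, mem_degreeLT]
    rw [Polynomial.degree_lt_iff_coeff_zero]
    rfl
  have hker : ∀ u, A.mulVec u = 0 → F.mulVec u = Pi.single 0 (F.mulVec u 0) := by
    intro u hu
    funext i
    refine Fin.cases ?_ (fun i => ?_) i
    · simp
    · have := congrFun hu i
      rw [Pi.single_eq_of_ne (Fin.succ_ne_zero i)]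
      exact this
  have hchain : ∀ j, ∀ u ∈ kerN A (r * d + 1 + j), F.mulVec u 0 ∈ chainW W j := by
    intro j
    induction j with
    | zero =>
      intro u hu
      rw [mem_kerN] at hu
      refine (hW _).2 ⟨(hI _).2 ⟨u, hker u hu.2⟩, fun k hk => ?_⟩
      refine mem_polyVec.1 (mulVec_mem_polyVec F d hF hu.1) 0 k ?_
      rw [hD, add_mul] at hk
      omega
    | succ j ih =>
      intro u hu
      have := kerN_succ A d hAd g hg (r * d + 1 + j) (by omega) hu
      obtain ⟨y, hy, _, ⟨z, hz, rfl⟩, rfl⟩ := Submodule.mem_sup.1 this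
      rw [Matrix.mulVec_add, mulVec_mulX, Pi.add_apply, mulX_apply]
      exact add_mem (chainW_mono_succ W j (ih y hy)) (X_mul_mem_chainW W j _ (ih z hz))
  obtain ⟨u, hu⟩ := (hI a).1 ha
  have huA : A.mulVec u = 0 := by
    funext i
    have := congrFun hu i.succ
    rw [Pi.single_eq_of_ne (Fin.succ_ne_zero i)] at this
    exact this
  set j := Finset.univ.sup fun i => (u i).natDegree with hj
  have huk : u ∈ kerN A (r * d + 1 + j) := by
    rw [mem_kerN]
    refine ⟨mem_polyVec.2 fun i k hk => coeff_eq_zero_of_natDegree_lt ?_, huA⟩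
    have : (u i).natDegree ≤ j := Finset.le_sup (f := fun i => (u i).natDegree) (Finset.mem_univ i)
    omega
  have h1 := hchain j u huk
  rw [hu, Pi.single_eq_same] at h1
  exact degree_drop I D W hW j a h1

theorem exists_cols {K : Type*} [Field K] {ι κ : Type*} [Fintype ι] [DecidableEq ι] [Fintype κ]
    (M : Matrix ι κ K) (hM : M.rank = Fintype.card ι) :
    ∃ f : ι → κ, (M.submatrix id f).det ≠ 0 := by
  obtain ⟨κ', a, ha, hspan, hli⟩ := exists_linearIndependent' K M.col
  have : Finite κ' := Finite.of_injective a ha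
  have := Fintype.ofFinite κ'
  have hcard : Fintype.card κ' = Fintype.card ι := by
    rw [← hM, Matrix.rank_eq_finrank_span_cols, ← hspan, finrank_span_eq_card hli]
  let e : ι ≃ κ' := (Fintype.equivOfCardEq hcard).symm
  refine ⟨a ∘ e, ?_⟩
  have h1 : LinearIndependent K (M.submatrix id (a ∘ e)).col := hli.comp e e.injective
  have h2 := Matrix.linearIndependent_cols_iff_isUnit.1 h1
  exact ((Matrix.isUnit_iff_isUnit_det _).1 h2).ne_zero

theorem sum_mul_adjugate {R : Type*} [CommRing R] {ι : Type*} [Fintype ι] [DecidableEq ι]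
    (B : Matrix ι ι R) (i : ι) (b : ι → R) :
    ∑ c, b c * B.adjugate c i = (B.updateRow i b).det := by
  rw [← Matrix.cramer_transpose_apply, Matrix.cramer_eq_adjugate_mulVec,
    ← Matrix.adjugate_transpose]
  simp [Matrix.mulVec, dotProduct, mul_comm]

theorem cramer_small {R C : Type*} [Fintype R] [DecidableEq R] [Fintype C] [DecidableEq C]
    (M : Matrix R C ℤ) (S : Finset R) (i0 : R) (u : C → ℚ)
    (hS : ∀ i ∈ S, ∑ c, (M i c : ℚ) * u c = 0) (h0 : ∑ c, (M i0 c : ℚ) * u c ≠ 0)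
    (H : ℝ) (hH1 : 1 ≤ H) (hH : ∀ i c, |(M i c : ℝ)| ≤ H) :
    ∃ w : C → ℤ, (∀ i ∈ S, M.mulVec w i = 0) ∧ M.mulVec w i0 ≠ 0 ∧
      ∀ i, |(M.mulVec w i : ℝ)| ≤ (((S.card + 1 : ℕ) : ℝ) * H) ^ (S.card + 1) := by
  let row : R → C → ℚ := fun i c => (M i c : ℚ)
  let dot : (C → ℚ) → (C → ℚ) →ₗ[ℚ] ℚ := fun w => ∑ c, w c • LinearMap.proj c
  have hdot : ∀ w v, dot w v = ∑ c, v c * w c := by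
    intro w v
    simp [dot, mul_comm]
  obtain ⟨κ, a, ha, hspan, hli⟩ := exists_linearIndependent' ℚ (fun i : S => row i)
  have : Finite κ := Finite.of_injective a ha
  have := Fintype.ofFinite κ
  classical
  have hcard : Fintype.card κ ≤ S.card := by
    have := Fintype.card_le_of_injective a ha
    simpa using this
  let g : Option κ → R := fun o => o.elim i0 (fun k => (a k : R))
  have hli' : LinearIndependent ℚ (fun o => row (g o)) := by
    rw [linearIndependent_option]
    refine ⟨hli, ?_⟩
    intro hmem
    have hmem' : row i0 ∈ Submodule.span ℚ (Set.range fun i : S => row i) := by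
      rw [← hspan]; exact hmem
    have hle : Submodule.span ℚ (Set.range fun i : S => row i) ≤ LinearMap.ker (dot u) := by
      rw [Submodule.span_le]
      rintro _ ⟨i, rfl⟩
      rw [SetLike.mem_coe, LinearMap.mem_ker, hdot]
      exact hS i i.2
    have := hle hmem'
    rw [LinearMap.mem_ker, hdot] at this
    exact h0 this
  let MQ : Matrix (Option κ) C ℚ := fun o => row (g o)
  obtain ⟨f, hf⟩ := exists_cols MQ (LinearIndependent.rank_matrix hli')
  let B : Matrix (Option κ) (Option κ) ℤ := M.submatrix g f
  have hB : B.det ≠ 0 := by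
    intro h
    apply hf
    have h2 : MQ.submatrix id f = (Int.castRingHom ℚ).mapMatrix B := by
      ext i j; rfl
    rw [h2, ← RingHom.map_det, h, map_zero]
  let w : C → ℤ := extVec f (fun c => B.adjugate c none)
  have hw : ∀ i, M.mulVec w i = (B.updateRow none (fun c => M i (f c))).det := by
    intro i
    rw [show M.mulVec w = (M.submatrix id f).mulVec (fun c => B.adjugate c none) from
      mulVec_extVec M f _, ← sum_mul_adjugate]
    rfl
  have hwk : ∀ k : κ, M.mulVec w (a k) = 0 := by
    intro k
    rw [hw]
    refine Matrix.det_zero_of_row_eq (i := none) (j := some k) (by simp) ?_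
    funext c
    simp [B, g]
  refine ⟨w, ?_, ?_, ?_⟩
  · intro i hi
    have hle : Submodule.span ℚ (Set.range fun i : S => row i) ≤
        LinearMap.ker (dot fun c => (w c : ℚ)) := by
      rw [← hspan, Submodule.span_le]
      rintro _ ⟨k, rfl⟩
      rw [SetLike.mem_coe, LinearMap.mem_ker, hdot]
      have := hwk k
      simp only [Matrix.mulVec, dotProduct] at this
      change ∑ c, (M (a k) c : ℚ) * (w c : ℚ) = 0
      exact_mod_cast this
    have := hle (Submodule.subset_span ⟨⟨i, hi⟩, rfl⟩)
    rw [LinearMap.mem_ker, hdot] at this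
    change ∑ c, (M i c : ℚ) * (w c : ℚ) = 0 at this
    simp only [Matrix.mulVec, dotProduct]
    exact_mod_cast this
  · rw [hw]
    have : B.updateRow none (fun c => M i0 (f c)) = B := Matrix.updateRow_eq_self B none
    rwa [this]
  · intro i
    rw [hw]
    set B' := B.updateRow none (fun c => M i (f c)) with hB'
    have hbd : ∀ x y, |((B'.map (Int.cast : ℤ → ℝ)) x y)| ≤ H := by
      intro x y
      rw [Matrix.map_apply]
      cases x with
      | none => rw [hB', Matrix.updateRow_self]; exact hH _ _
      | some k => rw [hB', Matrix.updateRow_ne (by simp)]; exact hH _ _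
    have hdet : ((B'.det : ℤ) : ℝ) = (B'.map (Int.cast : ℤ → ℝ)).det := Int.cast_det B'
    rw [hdet]
    have h1 := Matrix.det_le (abv := (AbsoluteValue.abs : AbsoluteValue ℝ ℝ)) hbd
    rw [AbsoluteValue.abs_apply, Fintype.card_option, nsmul_eq_mul] at h1
    refine h1.trans ?_
    set t := Fintype.card κ + 1 with ht
    have htT : t ≤ S.card + 1 := by omega
    have h2 : ((t.factorial : ℕ) : ℝ) ≤ (t : ℝ) ^ t := by exact_mod_cast Nat.factorial_le_pow t
    calc ((t.factorial : ℕ) : ℝ) * H ^ t ≤ (t : ℝ) ^ t * H ^ t := by gcongr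
      _ = ((t : ℝ) * H) ^ t := by rw [mul_pow]
      _ ≤ (((S.card + 1 : ℕ) : ℝ) * H) ^ t := by gcongr
      _ ≤ _ := by
        refine pow_le_pow_right₀ ?_ htT
        have : (1 : ℝ) ≤ ((S.card + 1 : ℕ) : ℝ) := by
          exact_mod_cast Nat.succ_le_succ (Nat.zero_le _)
        nlinarith

theorem natDegree_det_le {R : Type*} [CommRing R] {ι : Type*} [Fintype ι] [DecidableEq ι]
    (M : Matrix ι ι R[X]) (b : ι → ℕ) (hM : ∀ i j, (M i j).natDegree ≤ b i) :
    M.det.natDegree ≤ ∑ i, b i := by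
  rw [← Matrix.det_transpose, Matrix.det_apply]
  refine natDegree_sum_le_of_forall_le _ _ fun σ _ => ?_
  refine (natDegree_smul_le _ _).trans ?_
  refine (natDegree_prod_le _ _).trans ?_
  exact Finset.sum_le_sum fun i _ => hM _ _

theorem natDegree_adjugate_le {R : Type*} [CommRing R] {s : ℕ}
    (M : Matrix (Fin (s + 1)) (Fin (s + 1)) R[X]) (d : ℕ) (hM : ∀ i j, (M i j).natDegree ≤ d)
    (i j : Fin (s + 1)) : (M.adjugate i j).natDegree ≤ s * d := by
  rw [Matrix.adjugate_apply]
  refine (natDegree_det_le _ (fun k => if k = j then 0 else d) ?_).trans ?_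
  · intro k l
    by_cases hk : k = j
    · subst hk
      rw [Matrix.updateRow_self, Pi.single_apply]
      split_ifs <;> simp
    · rw [Matrix.updateRow_ne hk, if_neg hk]
      exact hM _ _
  · rw [Finset.sum_ite]
    simp [Finset.filter_ne']

theorem small_solution {k : Type*} [Field k] {s m : ℕ} (F : Matrix (Fin (s + 1)) (Fin m) k[X])
    (d : ℕ) (hd : 1 ≤ d) (hF : ∀ i j, (F i j).natDegree ≤ d)
    (f : Fin (s + 1) → Fin m) (hf : (F.submatrix id f).det ≠ 0) (u : Fin m → k[X])
    (hb : ∀ i, (F.mulVec u i).natDegree ≤ (F.submatrix id f).det.natDegree) :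
    ∃ u' ∈ polyVec k (Fin m) ((s + 1) * d), F.mulVec u' = F.mulVec u := by
  set B := F.submatrix id f with hB
  set D := B.det with hD
  have hDdeg : D.natDegree ≤ (s + 1) * d := by
    refine (natDegree_det_le B (fun _ => d) fun i j => hF _ _).trans ?_
    simp
  let q : Fin m → k[X] := fun j => u j / D
  let ρ : Fin m → k[X] := fun j => u j % D
  have hu : u = D • q + ρ := by
    funext j
    exact (EuclideanDomain.div_add_mod (u j) D).symm
  have hρ : ρ ∈ polyVec k (Fin m) D.natDegree := by
    refine mem_polyVec.2 fun j l hl => coeff_eq_zero_of_degree_lt ?_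
    refine (EuclideanDomain.mod_lt (u j) hf).trans_le ?_
    exact degree_le_natDegree.trans (by exact_mod_cast hl)
  let v : Fin (s + 1) → k[X] := B.adjugate.mulVec (F.mulVec q)
  have hBv : B.mulVec v = D • F.mulVec q := by
    change B.mulVec (B.adjugate.mulVec (F.mulVec q)) = _
    rw [Matrix.mulVec_mulVec, Matrix.mul_adjugate, Matrix.smul_mulVec, Matrix.one_mulVec]
  have hFu : F.mulVec u = D • F.mulVec q + F.mulVec ρ := by
    conv_lhs => rw [hu]
    rw [Matrix.mulVec_add, Matrix.mulVec_smul]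
  have hDv : D • v = B.adjugate.mulVec (F.mulVec u - F.mulVec ρ) := by
    rw [hFu, add_sub_cancel_right, ← hBv, Matrix.mulVec_mulVec, Matrix.adjugate_mul,
      Matrix.smul_mulVec, Matrix.one_mulVec]
  have hv : v ∈ polyVec k (Fin (s + 1)) ((s + 1) * d) := by
    have h1 : F.mulVec u ∈ polyVec k (Fin (s + 1)) (D.natDegree + d) :=
      mem_polyVec.2 fun i l hl => coeff_eq_zero_of_natDegree_lt ((hb i).trans_lt (by omega))
    have h2 := mulVec_mem_polyVec F d hF hρ
    have h3 := mulVec_mem_polyVec B.adjugate (s * d)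
      (natDegree_adjugate_le B d fun i j => hF _ _) (sub_mem h1 h2)
    rw [← hDv] at h3
    refine mem_polyVec.2 fun i l hl => ?_
    by_cases hvi : v i = 0
    · rw [hvi, coeff_zero]
    apply coeff_eq_zero_of_natDegree_lt
    by_contra hlt
    have h4 : (D * v i).natDegree = D.natDegree + (v i).natDegree := natDegree_mul hf hvi
    have h5 := mem_polyVec.1 h3 i (D * v i).natDegree (by rw [h4]; rw [add_mul] at hl; omega)
    rw [Pi.smul_apply, smul_eq_mul] at h5
    exact mul_ne_zero hf hvi (leadingCoeff_eq_zero.1 h5)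
  refine ⟨ρ + extVec f v, add_mem ?_ ?_, ?_⟩
  · have := mem_polyVec.1 hρ
    exact mem_polyVec.2 fun i l hl => this i l (by omega)
  · have hv' := mem_polyVec.1 hv
    refine mem_polyVec.2 fun j l hl => ?_
    simp only [extVec, finsetSum_coeff]
    refine Finset.sum_eq_zero fun i _ => ?_
    split_ifs
    · exact hv' i l hl
    · simp
  · rw [Matrix.mulVec_add, mulVec_extVec, ← hB, hBv, hFu]
    exact add_comm _ _

/-- polynomial vector with given coefficients -/
noncomputable def toPoly {R : Type*} [CommRing R] {m N : ℕ} (w : Fin m × Fin N → R) :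
    Fin m → R[X] := fun j => ∑ l : Fin N, C (w (j, l)) * X ^ (l : ℕ)

theorem coeff_mulVec_toPoly {R : Type*} [CommRing R] {ι : Type*} {m N : ℕ}
    (F : Matrix ι (Fin m) R[X]) (w : Fin m × Fin N → R) (i : ι) (k : ℕ) :
    (F.mulVec (toPoly w) i).coeff k =
      ∑ c : Fin m × Fin N, (F i c.1 * X ^ (c.2 : ℕ)).coeff k * w c := by
  simp only [Matrix.mulVec, dotProduct, toPoly, finsetSum_coeff, Finset.mul_sum,
    Fintype.sum_prod_type]
  refine Finset.sum_congr rfl fun j _ => Finset.sum_congr rfl fun l _ => ?_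
  rw [show F i j * (C (w (j, l)) * X ^ (l : ℕ)) = F i j * X ^ (l : ℕ) * C (w (j, l)) by ring,
    coeff_mul_C]

theorem toPoly_coeff {R : Type*} [CommRing R] {m N : ℕ} (u : Fin m → R[X])
    (hu : u ∈ polyVec R (Fin m) N) :
    toPoly (fun c : Fin m × Fin N => (u c.1).coeff c.2) = u := by
  funext j
  have h := mem_polyVec.1 hu j
  simp only [toPoly]
  ext k
  simp only [finsetSum_coeff, coeff_C_mul, coeff_X_pow]
  by_cases hk : k < N
  · rw [Finset.sum_eq_single (⟨k, hk⟩ : Fin N)]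
    · simp
    · intro b _ hb
      rw [if_neg, mul_zero]
      intro hkb
      exact hb (Fin.ext hkb.symm)
    · simp
  · rw [h k (by omega)]
    refine Finset.sum_eq_zero fun l _ => ?_
    rw [if_neg (by omega), mul_zero]

theorem small_generator {s m : ℕ} (F : Matrix (Fin (s + 1)) (Fin m) ℤ[X])
    (d : ℕ) (hd : 1 ≤ d) (hF : ∀ i j, (F i j).natDegree ≤ d)
    (f : Fin (s + 1) → Fin m) (hf : (F.submatrix id f).det ≠ 0) (u : Fin m → ℤ[X]) (a : ℤ[X])
    (hu : F.mulVec u = Pi.single 0 a) (ha : a ≠ 0)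
    (hdeg : a.natDegree ≤ (F.submatrix id f).det.natDegree)
    (H : ℝ) (hH1 : 1 ≤ H) (hH : ∀ i j k, |((F i j).coeff k : ℝ)| ≤ H) (T : ℕ)
    (hT : T = (s + 1) * ((s + 1) * d + d)) :
    ∃ w : Fin m → ℤ[X], ∃ ω : ℤ[X], F.mulVec w = Pi.single 0 ω ∧ ω.coeff a.natDegree ≠ 0 ∧
      (∀ k, a.natDegree < k → ω.coeff k = 0) ∧ ∀ k, |(ω.coeff k : ℝ)| ≤ ((T : ℝ) * H) ^ T := by
  set e := a.natDegree with he
  set N := (s + 1) * d with hN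
  have hDN : (F.submatrix id f).det.natDegree ≤ N := by
    refine (natDegree_det_le _ (fun _ => d) fun i j => hF _ _).trans ?_
    simp [hN]
  have heN : e < N + d := by omega
  -- rational solution of small degree
  let φ : ℤ[X] →+* ℚ[X] := Polynomial.mapRingHom (Int.castRingHom ℚ)
  have hφinj : Function.Injective φ :=
    Polynomial.map_injective _ (RingHom.injective_int (Int.castRingHom ℚ))
  have hφdeg : ∀ q, (φ q).natDegree = q.natDegree := fun q =>
    natDegree_map_eq_of_injective (RingHom.injective_int (Int.castRingHom ℚ)) q
  let FQ : Matrix (Fin (s + 1)) (Fin m) ℚ[X] := F.map φ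
  have hdetQ : (FQ.submatrix id f).det = φ (F.submatrix id f).det := by
    rw [RingHom.map_det]; rfl
  have hfQ : (FQ.submatrix id f).det ≠ 0 := by
    rw [hdetQ]
    exact (map_ne_zero_iff φ hφinj).2 hf
  have hFuQ : FQ.mulVec (φ ∘ u) = fun i => φ (Pi.single (M := fun _ => ℤ[X]) 0 a i) := by
    funext i
    rw [← hu, RingHom.map_mulVec]
  obtain ⟨u', hu', hFu'⟩ := small_solution FQ d hd
    (fun i j => by change (φ (F i j)).natDegree ≤ d; rw [hφdeg]; exact hF i j) f hfQ (φ ∘ u) (by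
      intro i
      rw [hFuQ, hdetQ, hφdeg, hφdeg]
      by_cases hi : i = 0
      · subst hi; rw [Pi.single_eq_same]; exact hdeg
      · rw [Pi.single_eq_of_ne hi]; simp)
  rw [hFuQ] at hFu'
  let M : Matrix (Fin (s + 1) × Fin (N + d)) (Fin m × Fin N) ℤ :=
    fun x c => (F x.1 c.1 * X ^ (c.2 : ℕ)).coeff x.2
  let uq : Fin m × Fin N → ℚ := fun c => (u' c.1).coeff c.2
  have hMu : ∀ x : Fin (s + 1) × Fin (N + d), ∑ c, (M x c : ℚ) * uq c =
      ((Pi.single (M := fun _ => ℤ[X]) 0 a x.1).coeff x.2 : ℚ) := by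
    intro x
    have h1 := coeff_mulVec_toPoly FQ uq x.1 x.2
    rw [toPoly_coeff u' hu', hFu'] at h1
    simp only [φ, coe_mapRingHom, coeff_map, eq_intCast] at h1
    rw [h1]
    refine Finset.sum_congr rfl fun c _ => ?_
    have : FQ x.1 c.1 * X ^ (c.2 : ℕ) = φ (F x.1 c.1 * X ^ (c.2 : ℕ)) := by
      simp [FQ, φ]
    rw [this]
    change ((M x c : ℤ) : ℚ) * uq c =
      (Polynomial.map (Int.castRingHom ℚ) (F x.1 c.1 * X ^ (c.2 : ℕ))).coeff x.2 * uq c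
    rw [coeff_map]
    rfl
  let S : Finset (Fin (s + 1) × Fin (N + d)) :=
    Finset.univ.filter fun x => x.1 ≠ 0 ∨ e < (x.2 : ℕ)
  let i0 : Fin (s + 1) × Fin (N + d) := (0, ⟨e, heN⟩)
  have hcard : S.card + 1 ≤ T := by
    have hsub : S ⊂ Finset.univ := by
      rw [Finset.ssubset_univ_iff]
      intro h
      have : i0 ∈ S := by rw [h]; exact Finset.mem_univ _
      simp [S, i0] at this
    have := Finset.card_lt_card hsub
    rw [Finset.card_univ, Fintype.card_prod, Fintype.card_fin, Fintype.card_fin] at this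
    rw [hT]; exact this
  obtain ⟨w, hw1, hw2, hw3⟩ := cramer_small M S i0 uq (by
      intro x hx
      rw [hMu]
      rcases (Finset.mem_filter.1 hx).2 with h | h
      · rw [Pi.single_eq_of_ne h]; simp
      · by_cases h0 : x.1 = 0
        · rw [h0, Pi.single_eq_same, coeff_eq_zero_of_natDegree_lt h, Int.cast_zero]
        · rw [Pi.single_eq_of_ne h0]; simp) (by
      rw [hMu]
      simp only [i0, Pi.single_eq_same]
      have : a.coeff e ≠ 0 := by
        rw [he]; exact leadingCoeff_ne_zero.2 ha
      exact_mod_cast this) H hH1 (by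
      intro x c
      simp only [M, coeff_mul_X_pow']
      split_ifs
      · exact hH _ _ _
      · simp; linarith)
  have hMw : ∀ x : Fin (s + 1) × Fin (N + d),
      M.mulVec w x = (F.mulVec (toPoly w) x.1).coeff x.2 := by
    intro x
    rw [coeff_mulVec_toPoly]
    rfl
  have hpoly : F.mulVec (toPoly w) ∈ polyVec ℤ (Fin (s + 1)) (N + d) := by
    refine mulVec_mem_polyVec F d hF ?_
    refine mem_polyVec.2 fun j k hk => ?_
    simp only [toPoly, finsetSum_coeff, coeff_C_mul, coeff_X_pow]
    refine Finset.sum_eq_zero fun l _ => ?_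
    rw [if_neg (by omega), mul_zero]
  have hpoly' := mem_polyVec.1 hpoly
  have hTH : (1 : ℝ) ≤ ((S.card + 1 : ℕ) : ℝ) * H := by
    have : (1 : ℝ) ≤ ((S.card + 1 : ℕ) : ℝ) := by
      exact_mod_cast Nat.succ_le_succ (Nat.zero_le _)
    nlinarith
  have hbound : (((S.card + 1 : ℕ) : ℝ) * H) ^ (S.card + 1) ≤ ((T : ℝ) * H) ^ T := by
    have h1 : (((S.card + 1 : ℕ) : ℝ)) ≤ (T : ℝ) := by exact_mod_cast hcard
    calc (((S.card + 1 : ℕ) : ℝ) * H) ^ (S.card + 1) ≤ (((S.card + 1 : ℕ) : ℝ) * H) ^ T :=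
          pow_le_pow_right₀ hTH hcard
      _ ≤ _ := by gcongr
  refine ⟨toPoly w, F.mulVec (toPoly w) 0, ?_, ?_, ?_, ?_⟩
  · funext i
    by_cases hi : i = 0
    · subst hi; rw [Pi.single_eq_same]
    · rw [Pi.single_eq_of_ne hi]
      ext k
      rw [coeff_zero]
      by_cases hk : N + d ≤ k
      · exact hpoly' i k hk
      · have := hw1 (i, ⟨k, by omega⟩) (by simp [S, hi])
        rwa [hMw] at this
  · rwa [hMw] at hw2
  · intro k hk
    by_cases hk' : N + d ≤ k
    · exact hpoly' 0 k hk'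
    · have := hw1 (0, ⟨k, by omega⟩) (by simp [S, hk])
      rwa [hMw] at this
  · intro k
    refine le_trans ?_ hbound
    by_cases hk' : N + d ≤ k
    · rw [hpoly' 0 k hk', Int.cast_zero, abs_zero]
      positivity
    · have := hw3 (0, ⟨k, by omega⟩)
      rwa [hMw] at this

theorem lower_coeffs (I : Ideal ℤ[X]) (e : ℕ)
    (hmin : ∀ g ∈ I, (∀ k, e ≤ k → g.coeff k = 0) → g = 0) (ω : ℤ[X]) (hω : ω ∈ I)
    (hωe : ω.coeff e ≠ 0) (hωk : ∀ k, e < k → ω.coeff k = 0) (B : ℝ)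
    (hB : ∀ k, |(ω.coeff k : ℝ)| ≤ B) (s : ℕ) : ∀ (g : ℤ[X]) (C : ℝ), g ∈ I →
    (∀ k, e + s ≤ k → g.coeff k = 0) → (∀ k, e ≤ k → |(g.coeff k : ℝ)| ≤ C) →
    ∀ k, k < e → |(g.coeff k : ℝ)| ≤ C * ((1 + B) ^ s - 1) := by
  have hB0 : 0 ≤ B := (abs_nonneg _).trans (hB 0)
  induction s with
  | zero =>
    intro g C hg h0 _ k _
    rw [hmin g hg h0]
    simp
  | succ s ih =>
    intro g K hg h0 hK k hk
    have hK0 : 0 ≤ K := (abs_nonneg _).trans (hK e le_rfl)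
    set α : ℝ := |(ω.coeff e : ℝ)| with hα
    have hα1 : 1 ≤ α := by
      have : (1 : ℤ) ≤ |ω.coeff e| := Int.one_le_abs hωe
      rw [hα]
      exact_mod_cast this
    set g' : ℤ[X] := C (ω.coeff e) * g - C (g.coeff (e + s)) * (X ^ s * ω) with hg'
    have hg'I : g' ∈ I := I.sub_mem (I.mul_mem_left _ hg)
      (I.mul_mem_left _ (I.mul_mem_left _ hω))
    have hco : ∀ j, g'.coeff j = ω.coeff e * g.coeff j -
        g.coeff (e + s) * (X ^ s * ω).coeff j := by
      intro j
      rw [hg', coeff_sub, coeff_C_mul, coeff_C_mul]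
    have hXω : ∀ j, |((X ^ s * ω).coeff j : ℝ)| ≤ B := by
      intro j
      rw [coeff_X_pow_mul']
      split_ifs
      · exact hB _
      · simpa using hB0
    have hcoR : ∀ j, (g'.coeff j : ℝ) = (ω.coeff e : ℝ) * (g.coeff j : ℝ) -
        (g.coeff (e + s) : ℝ) * ((X ^ s * ω).coeff j : ℝ) := by
      intro j
      rw [hco]; push_cast; ring
    have hprod : ∀ j, |(g.coeff (e + s) : ℝ) * ((X ^ s * ω).coeff j : ℝ)| ≤ K * B := by
      intro j
      rw [abs_mul]
      exact mul_le_mul (hK _ (by omega)) (hXω j) (abs_nonneg _) hK0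
    have h0' : ∀ j, e + s ≤ j → g'.coeff j = 0 := by
      intro j hj
      rw [hco, coeff_X_pow_mul', if_pos (by omega)]
      rcases Nat.eq_or_lt_of_le hj with h | h
      · subst h
        rw [Nat.add_sub_cancel]; ring
      · rw [h0 j (by omega), hωk (j - s) (by omega)]; ring
    have hK' : ∀ j, e ≤ j → |(g'.coeff j : ℝ)| ≤ α * (K * (1 + B)) := by
      intro j hj
      rw [hcoR]
      refine (abs_sub _ _).trans ?_
      rw [abs_mul, ← hα]
      have h1 := hK j hj
      have h2 := hprod j
      have h3 : α * |(g.coeff j : ℝ)| ≤ α * K := by gcongr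
      have h4 : K * B ≤ α * (K * B) := by nlinarith [mul_nonneg hK0 hB0]
      linarith
    have h1 := ih g' _ hg'I h0' hK' k hk
    have h2 : (ω.coeff e : ℝ) * (g.coeff k : ℝ) =
        (g'.coeff k : ℝ) + (g.coeff (e + s) : ℝ) * ((X ^ s * ω).coeff k : ℝ) := by
      rw [hcoR]; ring
    have h3 : α * |(g.coeff k : ℝ)| ≤ α * (K * (1 + B)) * ((1 + B) ^ s - 1) + K * B := by
      rw [hα, ← abs_mul, h2]
      exact (abs_add_le _ _).trans (add_le_add h1 (hprod k))
    have h4 : K * B ≤ α * (K * B) := by nlinarith [mul_nonneg hK0 hB0]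
    have h5 : α * |(g.coeff k : ℝ)| ≤ α * (K * ((1 + B) ^ (s + 1) - 1)) := by
      refine h3.trans ((add_le_add_right h4 _).trans (le_of_eq ?_))
      ring
    exact le_of_mul_le_mul_left h5 (by linarith)

theorem polyHeight_le (f : ℤ[X]) (Y : ℝ) (hY : 1 ≤ Y) (hf : ∀ k, |(f.coeff k : ℝ)| ≤ Y) :
    polyHeight f ≤ Real.log Y := by
  unfold polyHeight
  set S := (Finset.range (f.natDegree + 1)).sup fun k => (f.coeff k).natAbs with hS
  have hSY : (S : ℝ) ≤ Y := by
    obtain ⟨k, -, hk⟩ := Finset.exists_mem_eq_sup (Finset.range (f.natDegree + 1))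
      ⟨0, by simp⟩ (fun k => (f.coeff k).natAbs)
    rw [hS, hk, Nat.cast_natAbs, Int.cast_abs]
    exact hf k
  rcases Nat.eq_zero_or_pos S with h | h
  · rw [h]; simpa using Real.log_nonneg hY
  · exact Real.log_le_log (by exact_mod_cast h) hSY

theorem polyHeight_nonneg (f : ℤ[X]) : 0 ≤ polyHeight f := Real.log_natCast_nonneg _

theorem abs_coeff_le_exp (f : ℤ[X]) (h : ℝ) (hf : polyHeight f ≤ h) (k : ℕ) :
    |(f.coeff k : ℝ)| ≤ Real.exp h := by
  by_cases hk : f.coeff k = 0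
  · rw [hk]; simpa using (Real.exp_pos h).le
  · have hk' : k ∈ Finset.range (f.natDegree + 1) := by
      rw [Finset.mem_range]
      have := le_natDegree_of_ne_zero hk
      omega
    have h1 : (f.coeff k).natAbs ≤
        (Finset.range (f.natDegree + 1)).sup fun k => (f.coeff k).natAbs :=
      Finset.le_sup (f := fun k => (f.coeff k).natAbs) hk'
    have h2 : 0 < (f.coeff k).natAbs := Int.natAbs_pos.2 hk
    have h3 : |(f.coeff k : ℝ)| = ((f.coeff k).natAbs : ℝ) := by
      rw [Nat.cast_natAbs, Int.cast_abs]
    rw [h3]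
    refine le_trans (Nat.cast_le.2 h1) ?_
    rw [← Real.log_le_iff_le_exp (by exact_mod_cast h2.trans_le h1)]
    exact hf

theorem numeric (n d : ℕ) (hn : 1 ≤ n) (hd : 1 ≤ d) (h : ℝ) (hh : 0 ≤ h) (T : ℕ)
    (hT : T = n * (n * d + d)) (B : ℝ) (hB : B = ((T : ℝ) * Real.exp h) ^ T) :
    1 ≤ B ∧ Real.log (B * (1 + B) ^ (n * d)) ≤ 6 * (n : ℝ) ^ 3 * (d : ℝ) ^ 2 *
        (h + 1 + Real.log ((n : ℝ) ^ 2 * (d : ℝ))) := by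
  have hn' : (1 : ℝ) ≤ n := by exact_mod_cast hn
  have hd' : (1 : ℝ) ≤ d := by exact_mod_cast hd
  have hnd : (1 : ℝ) ≤ (n : ℝ) * d := one_le_mul_of_one_le_of_one_le hn' hd'
  have hnnd : (1 : ℝ) ≤ (n : ℝ) ^ 2 * d :=
    one_le_mul_of_one_le_of_one_le (one_le_pow₀ hn') hd'
  set ℓ := Real.log ((n : ℝ) ^ 2 * (d : ℝ)) with hℓ
  have hℓ0 : 0 ≤ ℓ := Real.log_nonneg hnnd
  have hT1 : (1 : ℝ) ≤ T := by
    have : 1 ≤ T := by rw [hT]; exact Nat.mul_pos hn (by omega)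
    exact_mod_cast this
  have hT2 : (T : ℝ) ≤ 2 * ((n : ℝ) ^ 2 * d) := by
    rw [hT]; push_cast
    nlinarith [mul_nonneg (mul_nonneg (by linarith : (0:ℝ) ≤ n) (by linarith : (0:ℝ) ≤ n - 1))
      (by linarith : (0:ℝ) ≤ d)]
  have hTe : (1 : ℝ) ≤ (T : ℝ) * Real.exp h :=
    one_le_mul_of_one_le_of_one_le hT1 (Real.one_le_exp hh)
  have hB1 : 1 ≤ B := by rw [hB]; exact one_le_pow₀ hTe
  have hlogT : Real.log T ≤ Real.log 2 + ℓ := by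
    rw [hℓ, ← Real.log_mul (by norm_num) (by positivity)]
    exact Real.log_le_log (by linarith) hT2
  have hl2 : Real.log 2 ≤ 0.7 := by linarith [Real.log_two_lt_d9]
  have hl20 : 0 ≤ Real.log 2 := Real.log_nonneg (by norm_num)
  have hlogB : Real.log B = T * (Real.log T + h) := by
    rw [hB, Real.log_pow, Real.log_mul (by linarith) (Real.exp_pos h).ne', Real.log_exp]
  have hlogT0 : 0 ≤ Real.log T := Real.log_nonneg hT1
  have hlogB2 : Real.log B ≤ 2 * ((n : ℝ) ^ 2 * d) * (0.7 + ℓ + h) := by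
    rw [hlogB]
    refine mul_le_mul hT2 (by linarith) (by linarith) (by positivity)
  have hlogB0 : 0 ≤ Real.log B := Real.log_nonneg hB1
  refine ⟨hB1, ?_⟩
  have h1B : Real.log (1 + B) ≤ Real.log 2 + Real.log B := by
    rw [← Real.log_mul (by norm_num) (by linarith)]
    exact Real.log_le_log (by linarith) (by linarith)
  rw [Real.log_mul (by linarith) (by positivity), Real.log_pow]
  push_cast
  have h2 : (n : ℝ) * d * Real.log (1 + B) ≤ (n : ℝ) * d * (0.7 + Real.log B) := by
    gcongr; linarith
  have h3 : Real.log B ≤ (n : ℝ) * d * Real.log B := le_mul_of_one_le_left hlogB0 hnd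
  have h4 : (n : ℝ) * d * Real.log B ≤
      (n : ℝ) * d * (2 * ((n : ℝ) ^ 2 * d) * (0.7 + ℓ + h)) := by gcongr
  have h5 : (n : ℝ) * d ≤ (n : ℝ) ^ 3 * d ^ 2 := by
    have : (n : ℝ) ^ 3 * d ^ 2 = (n : ℝ) * d * ((n : ℝ) ^ 2 * d) := by ring
    rw [this]
    exact le_mul_of_one_le_right (by linarith) hnnd
  have h6 : 0 ≤ (n : ℝ) ^ 3 * d ^ 2 := by positivity
  have h7 : 0 ≤ (n : ℝ) ^ 3 * d ^ 2 * h := by positivity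
  have h8 : 0 ≤ (n : ℝ) ^ 3 * d ^ 2 * ℓ := by positivity
  nlinarith

theorem main {s m : ℕ} (F : Matrix (Fin (s + 1)) (Fin m) ℤ[X])
    (f : Fin (s + 1) → Fin m) (hf : (F.submatrix id f).det ≠ 0)
    (d : ℕ) (hd1 : 1 ≤ d) (hd : ∀ i j, (F i j).natDegree ≤ d)
    (h : ℝ) (hh : ∀ i j, polyHeight (F i j) ≤ h)
    (I : Ideal ℤ[X]) (hI : ∀ a, a ∈ I ↔ ∃ u, F.mulVec u = Pi.single 0 a)
    (G : Finset ℤ[X]) (hG : IsReducedGroebnerBasis G I) (c : ℤ[X]) (hc : c ∈ G) :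
    c.natDegree ≤ (s + 1) * d ∧ polyHeight c ≤ 6 * ((s + 1 : ℕ) : ℝ) ^ 3 * (d : ℝ) ^ 2 *
        (h + 1 + Real.log (((s + 1 : ℕ) : ℝ) ^ 2 * (d : ℝ))) := by
  obtain ⟨⟨hpos, hsub, -, hgb⟩, hred⟩ := hG
  have hdegG : ∀ c ∈ G, c.natDegree ≤ (s + 1) * d := by
    intro c hc
    rcases low_degree F d hd f hf I hI c (hsub hc) with h | ⟨b, hb, hb0, hbd, hbl⟩
    · exact h
    · exfalso
      obtain ⟨g, hg, hgd, hgl⟩ := hgb b hb hb0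
      have hne : c ≠ g := by
        rintro rfl
        omega
      have h1 := (hred c hc g hg hne c.natDegree (by omega)).2
      rw [hbl] at hgl
      have h2 := Int.le_of_dvd (hpos c hc).2 hgl
      rw [coeff_natDegree] at h1
      omega
  refine ⟨hdegG c hc, ?_⟩
  have hh0 : 0 ≤ h := (polyHeight_nonneg _).trans (hh 0 (f 0))
  -- determinant
  have hdetI : (F.submatrix id f).det ∈ I := by
    rw [hI]
    refine ⟨extVec f (fun k => (F.submatrix id f).adjugate k 0), ?_⟩
    rw [mulVec_extVec]
    funext i
    have := congrFun (congrFun (Matrix.mul_adjugate (F.submatrix id f)) i) 0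
    rw [Matrix.mul_apply] at this
    rw [Matrix.mulVec, dotProduct, this, Matrix.smul_apply, Matrix.one_apply, Pi.single_apply]
    simp
  classical
  have hex : ∃ e, ∃ a ∈ I, a ≠ 0 ∧ a.natDegree = e := ⟨_, _, hdetI, hf, rfl⟩
  obtain ⟨a, haI, ha0, hae⟩ := Nat.find_spec hex
  have hmin' : ∀ b ∈ I, b ≠ 0 → a.natDegree ≤ b.natDegree := by
    intro b hb hb0
    rw [hae]
    exact Nat.find_min' hex ⟨b, hb, hb0, rfl⟩
  clear hae
  obtain ⟨u, hu⟩ := (hI a).1 haI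
  set T := (s + 1) * ((s + 1) * d + d) with hT
  obtain ⟨w, ω, hwω, hωe, hωk, hωB⟩ := small_generator F d hd1 hd f hf u a hu ha0
    (hmin' _ hdetI hf) (Real.exp h) (Real.one_le_exp hh0)
    (fun i j k => abs_coeff_le_exp _ _ (hh i j) k) T hT
  set B : ℝ := ((T : ℝ) * Real.exp h) ^ T with hB
  obtain ⟨hB1, hnum⟩ := numeric (s + 1) d (by omega) hd1 h hh0 T hT B hB
  set e := a.natDegree with he
  have hωI : ω ∈ I := (hI ω).2 ⟨w, hwω⟩
  have hω0 : ω ≠ 0 := by rintro rfl; simp at hωe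
  have hωd : ω.natDegree = e := by
    refine le_antisymm ?_ (le_natDegree_of_ne_zero hωe)
    exact natDegree_le_iff_coeff_eq_zero.2 hωk
  obtain ⟨c0, hc0, hc0d, hc0l⟩ := hgb ω hωI hω0
  have hc0e : c0.natDegree = e :=
    le_antisymm (hc0d.trans hωd.le) (hmin' _ (hsub hc0) (hpos _ hc0).1)
  have hc0B : ((c0.leadingCoeff : ℤ) : ℝ) ≤ B := by
    have h1 : c0.leadingCoeff ≤ |ω.leadingCoeff| :=
      Int.le_of_dvd (abs_pos.2 (leadingCoeff_ne_zero.2 hω0)) ((dvd_abs _ _).2 hc0l)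
    have h2 : ((c0.leadingCoeff : ℤ) : ℝ) ≤ |((ω.leadingCoeff : ℤ) : ℝ)| := by
      exact_mod_cast h1
    exact h2.trans (hωB ω.natDegree)
  have hupper : ∀ k, e ≤ k → |(c.coeff k : ℝ)| ≤ B := by
    intro k hk
    by_cases hcc : c = c0
    · subst hcc
      rcases Nat.eq_or_lt_of_le hk with h | h
      · rw [← h, ← hc0e, coeff_natDegree, abs_of_pos (by exact_mod_cast (hpos c hc).2)]
        exact hc0B
      · rw [coeff_eq_zero_of_natDegree_lt (by omega)]
        simp; linarith
    · obtain ⟨h1, h2⟩ := hred c hc c0 hc0 hcc k (by omega)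
      rw [abs_of_nonneg (by exact_mod_cast h1)]
      refine le_trans ?_ hc0B
      exact_mod_cast h2.le
  have hcD := hdegG c hc
  refine (polyHeight_le c (B * (1 + B) ^ ((s + 1) * d)) ?_ ?_).trans hnum
  · exact one_le_mul_of_one_le_of_one_le hB1 (one_le_pow₀ (by linarith))
  · intro k
    by_cases hk : e ≤ k
    · refine (hupper k hk).trans ?_
      exact le_mul_of_one_le_right (by linarith) (one_le_pow₀ (by linarith))
    · have hmin : ∀ g ∈ I, (∀ k, e ≤ k → g.coeff k = 0) → g = 0 := by
        intro g hg hgk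
        by_contra hg0
        exact leadingCoeff_ne_zero.2 hg0 (hgk _ (hmin' g hg hg0))
      have h1 := lower_coeffs I e hmin ω hωI hωe hωk B hωB ((s + 1) * d + 1 - e) c B (hsub hc)
        (fun j hj => coeff_eq_zero_of_natDegree_lt (by omega)) hupper k (by omega)
      refine h1.trans ?_
      have h2 : (1 + B) ^ ((s + 1) * d + 1 - e) ≤ (1 + B) ^ ((s + 1) * d) :=
        pow_le_pow_right₀ (by linarith) (by omega)
      have h3 : (1 + B) ^ ((s + 1) * d + 1 - e) - 1 ≤ (1 + B) ^ ((s + 1) * d) := by linarith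
      exact mul_le_mul_of_nonneg_left h3 (by linarith)

end GHNF

/-- Let F ∈ ℤ[x]^{n×m} have full row rank n over ℚ(x), with d = deg(F) ≥ 1
and h = height(F); let L be the ℤ[x]-module generated by the columns of F and
I₁ = {a ∈ ℤ[x] : (a,0,…,0)ᵗ ∈ L}. If I₁ ≠ 0 and {c₁,…,c_l} is a reduced Gröbner basis
of I₁, then deg(c_j) ≤ n·d and height(c_j) ≤ 6n³d²(h + 1 + log(n²d)) for every j. -/
theorem stmt17 {n m : ℕ} (hn : 0 < n) (F : Matrix (Fin n) (Fin m) (Polynomial ℤ))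
    (hrank : (F.map fun q =>
      algebraMap (Polynomial ℚ) (RatFunc ℚ) (q.map (Int.castRingHom ℚ))).rank = n)
    (d : ℕ) (hd1 : 1 ≤ d) (hd : ∀ i j, (F i j).natDegree ≤ d)
    (h : ℝ) (hh : ∀ i j, polyHeight (F i j) ≤ h)
    (L : Submodule (Polynomial ℤ) (Fin n → Polynomial ℤ))
    (hL : L = Submodule.span (Polynomial ℤ)
      (Set.range fun j : Fin m => fun i : Fin n => F i j))
    (I₁ : Ideal (Polynomial ℤ))
    (hI₁ : I₁ = Submodule.comap
      (LinearMap.single (Polynomial ℤ) (fun _ : Fin n => Polynomial ℤ) ⟨0, hn⟩) L)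
    (hI₁ne : I₁ ≠ ⊥)
    {l : ℕ} (c : Fin l → Polynomial ℤ)
    (hc : IsReducedGroebnerBasis (Finset.image c Finset.univ) I₁) :
    ∀ j : Fin l, (c j).natDegree ≤ n * d ∧
      polyHeight (c j) ≤ 6 * (n : ℝ) ^ 3 * (d : ℝ) ^ 2 *
        (h + 1 + Real.log ((n : ℝ) ^ 2 * (d : ℝ))) := by
  obtain ⟨s, rfl⟩ : ∃ s, n = s + 1 := ⟨n - 1, by omega⟩
  let ψ : ℤ[X] →+* RatFunc ℚ :=
    (algebraMap ℚ[X] (RatFunc ℚ)).comp (Polynomial.mapRingHom (Int.castRingHom ℚ))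
  obtain ⟨f, hf⟩ := GHNF.exists_cols (F.map ψ) (by rw [Fintype.card_fin]; exact hrank)
  have hf' : (F.submatrix id f).det ≠ 0 := by
    intro h0
    apply hf
    have := RingHom.map_det ψ (F.submatrix id f)
    rw [h0, map_zero] at this
    exact this.symm
  have hI : ∀ a, a ∈ I₁ ↔ ∃ u, F.mulVec u = Pi.single 0 a := by
    intro a
    have hrange : LinearMap.range F.mulVecLin = L := by
      rw [hL, Matrix.range_mulVecLin]
      rfl
    rw [hI₁, Submodule.mem_comap, ← hrange, LinearMap.mem_range]
    rfl
  intro j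
  exact GHNF.main F f hf' d hd1 hd h hh I₁ hI _ hc (c j)
    (Finset.mem_image_of_mem c (Finset.mem_univ j))
end

section
/- Let F ∈ ℤ[x]^{n×m} be a matrix of full row rank n (over ℚ(x)) with d = deg(F) ≥ 1 and h = height(F), and let L ⊆ ℤ[x]^n be the ℤ[x]-submodule generated by the columns of F. Then for every vector b ∈ L with deg(b) ≤ n·d and height(b) ≤ 6n³d²(h + 1 + log(n²d)), there exists a column vector u ∈ ℤ[x]^m with F·u = b and deg(u) ≤ 73·n⁸·d⁵·(h + 1 + log(n²d)). -/
open Polynomial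

theorem aux_natDegree_det_le {R : Type*} [CommRing R] {ι : Type*} [Fintype ι] [DecidableEq ι]
    (M : Matrix ι ι R[X]) (f : ι → ℕ) (hf : ∀ i j, (M i j).natDegree ≤ f j) :
    M.det.natDegree ≤ ∑ j, f j := by
  rw [Matrix.det_apply]
  refine natDegree_sum_le_of_forall_le _ _ fun s _ => ?_
  have h1 : (∏ i, M (s i) i).natDegree ≤ ∑ j, f j :=
    (natDegree_prod_le _ _).trans (Finset.sum_le_sum fun i _ => hf _ _)
  rcases Int.units_eq_one_or (Equiv.Perm.sign s) with h | h
  · simpa [h] using h1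
  · simpa [h] using h1

theorem aux_solve {R : Type*} [CommRing R] [IsDomain R] {n m : ℕ}
    (F : Matrix (Fin n) (Fin m) R[X]) (d : ℕ) (hd : ∀ i j, (F i j).natDegree ≤ d)
    (σ : Fin n → Fin m) (t W U Z : R[X])
    (hD : (F.submatrix id σ).det = t * (W * U)) (ht : t ≠ 0) (hW : W.Monic) (hU : U ≠ 0)
    (hdiv : ∀ τ : Fin n → Fin m, t ∣ (F.submatrix id τ).det)
    (u : Fin m → R[X]) (b : Fin n → R[X]) (hb : F.mulVec u = b)
    (hbd : ∀ i, (b i).natDegree ≤ n * d) (A : ℕ) (hA : (U * Z).natDegree ≤ A) :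
    ∃ u' : Fin m → R[X], F.mulVec u' = (U * Z) • b ∧
      ∀ j, (u' j).natDegree ≤ A + 2 * (n * d) := by
  classical
  set F0 := F.submatrix id σ with hF0
  set D' := W * U with hD'
  have hD'0 : D' ≠ 0 := mul_ne_zero hW.ne_zero hU
  have hdet0 : F0.det ≠ 0 := by rw [hD]; exact mul_ne_zero ht hD'0
  have hcr : ∀ i j, F0.cramer (fun k => F k j) i = (F.submatrix id (Function.update σ i j)).det := by
    intro i j
    rw [Matrix.cramer_apply]
    congr 1
    ext k l
    by_cases hl : l = i
    · subst hl; simp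
    · simp [hl, F0]
  choose G hG using fun i j => hdiv (Function.update σ i j)
  have hG' : ∀ i j, F0.cramer (fun k => F k j) i = t * G i j := fun i j => (hcr i j).trans (hG i j)
  -- degree of minors
  have hmin : ∀ τ : Fin n → Fin m, (F.submatrix id τ).det.natDegree ≤ n * d := by
    intro τ
    refine (aux_natDegree_det_le _ (fun _ => d) (fun i j => hd _ _)).trans ?_
    simp
  have hinj : Function.Injective σ := by
    intro i j hij
    by_contra hne
    apply hdet0
    exact Matrix.det_zero_of_column_eq hne (fun k => by simp [F0, hij])
  have hGσ : ∀ i i', G i (σ i') = if i = i' then D' else 0 := by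
    intro i i'
    apply mul_left_cancel₀ ht
    rw [← hG]
    split_ifs with h
    · subst h
      simp [← hD, F0]
    · rw [mul_zero]
      refine Matrix.det_zero_of_column_eq h (fun k => ?_)
      simp [Ne.symm h]
  -- the relation for kernel vectors
  have hker : ∀ j k, ∑ i, F k (σ i) * G i j = D' * F k j := by
    intro j k
    apply mul_left_cancel₀ ht
    have := congrFun (Matrix.mulVec_cramer F0 (fun k => F k j)) k
    simp only [Matrix.mulVec, dotProduct, hG', Pi.smul_apply, smul_eq_mul, hD] at this
    rw [Finset.mul_sum, ← mul_assoc, ← this]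
    refine Finset.sum_congr rfl fun i _ => ?_
    simp [F0]; ring
  set q : Fin m → R[X] := fun j => (Z * u j) /ₘ W with hq
  set r : Fin m → R[X] := fun j => (Z * u j) %ₘ W with hr
  have hqr : ∀ j, Z * u j = r j + W * q j := fun j => (modByMonic_add_div _ _).symm
  let u' : Fin m → R[X] := fun l =>
    U * Z * u l - (D' * q l - ∑ i, if σ i = l then ∑ j, G i j * q j else 0)
  have hFu : F.mulVec u' = (U * Z) • b := by
    subst hb
    ext1 k
    simp only [Matrix.mulVec, dotProduct, Pi.smul_apply, smul_eq_mul, u', mul_sub,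
      Finset.sum_sub_distrib]
    have h1 : ∑ l, F k l * ∑ i, (if σ i = l then ∑ j, G i j * q j else 0)
        = ∑ l, F k l * (D' * q l) := by
      calc _ = ∑ i, F k (σ i) * ∑ j, G i j * q j := by
            simp_rw [Finset.mul_sum]
            rw [Finset.sum_comm]
            refine Finset.sum_congr rfl fun i _ => ?_
            simp [Finset.mul_sum]
        _ = ∑ j, (∑ i, F k (σ i) * G i j) * q j := by
            simp_rw [Finset.mul_sum, Finset.sum_mul]
            rw [Finset.sum_comm]
            simp_rw [mul_assoc]
        _ = _ := by
            refine Finset.sum_congr rfl fun j _ => ?_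
            rw [hker]; ring
    rw [h1, sub_self, sub_zero, Finset.mul_sum]
    refine Finset.sum_congr rfl fun i _ => ?_
    ring
  have hout : ∀ l, l ∉ Set.range σ → u' l = U * r l := by
    intro l hl
    have : ∀ i, σ i ≠ l := fun i hi => hl ⟨i, hi⟩
    simp only [u', this, if_false, Finset.sum_const_zero, sub_zero]
    rw [mul_assoc, hqr, hD']; ring
  have hdD : D'.natDegree ≤ F0.det.natDegree := by
    rw [hD, natDegree_mul ht hD'0]; omega
  have hUr : ∀ l, (U * r l).natDegree ≤ D'.natDegree := by
    intro l
    refine natDegree_mul_le.trans ?_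
    have : (r l).natDegree ≤ W.natDegree := natDegree_modByMonic_le _ hW
    rw [hD', natDegree_mul hW.ne_zero hU]
    omega
  have hDn : F0.det.natDegree ≤ n * d := hmin σ
  refine ⟨u', hFu, fun l => ?_⟩
  by_cases hl : l ∈ Set.range σ
  swap
  · rw [hout l hl]
    have := hUr l
    omega
  obtain ⟨i, rfl⟩ := hl
  -- Cramer
  have hc : F0.cramer ((U * Z) • b) i = ∑ j, t * G i j * u' j := by
    rw [← hFu]
    have : F.mulVec u' = ∑ j, u' j • (fun k => F k j) := by
      ext1 k
      simp [Matrix.mulVec, dotProduct, mul_comm]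
    rw [this, map_sum, Finset.sum_apply]
    refine Finset.sum_congr rfl fun j _ => ?_
    rw [map_smul, Pi.smul_apply, hG', smul_eq_mul, mul_comm]
  have hc2 : F0.det * u' (σ i) = F0.cramer ((U * Z) • b) i
      - ∑ j ∈ Finset.univ.filter (fun j => j ∉ Set.range σ), t * G i j * u' j := by
    rw [hc, ← Finset.sum_filter_add_sum_filter_not _ (fun j => j ∉ Set.range σ),
      add_sub_cancel_left]
    have : Finset.univ.filter (fun j => ¬ (j ∉ Set.range σ)) = Finset.univ.image σ := by
      ext j; simp
    rw [this, Finset.sum_image (fun _ _ _ _ h => hinj h), Finset.sum_eq_single i]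
    · simp [hGσ, hD]
    · intro i' _ hne
      simp [hGσ, Ne.symm hne]
    · simp
  have hdeg : (F0.det * u' (σ i)).natDegree ≤ A + 2 * (n * d) + F0.det.natDegree := by
    rw [hc2]
    refine (natDegree_sub_le _ _).trans (max_le ?_ ?_)
    · rw [Matrix.cramer_apply]
      refine (aux_natDegree_det_le _ (fun j => if j = i then A + n * d else d) ?_).trans ?_
      · intro k j
        by_cases hj : j = i
        · subst hj
          simp only [Matrix.updateCol_self, Pi.smul_apply, smul_eq_mul, if_true]
          exact natDegree_mul_le.trans (Nat.add_le_add hA (hbd k))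
        · simp [hj, F0, hd]
      · calc ∑ j, (if j = i then A + n * d else d) ≤ ∑ j, ((if j = i then A + n * d else 0) + d) := by
              refine Finset.sum_le_sum fun j _ => ?_
              split_ifs <;> omega
          _ = A + n * d + n * d := by simp [Finset.sum_add_distrib]
          _ ≤ _ := by omega
    · refine natDegree_sum_le_of_forall_le _ _ fun j hj => ?_
      have hj' : j ∉ Set.range σ := by simpa using hj
      rw [hout j hj', ← hG]
      refine natDegree_mul_le.trans ?_
      have := hmin (Function.update σ i j)
      have := hUr j
      omega
  by_cases hz : u' (σ i) = 0
  · simp [hz]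
  rw [natDegree_mul hdet0 hz] at hdeg
  omega

theorem aux_factor {p : ℕ} [hp : Fact p.Prime] (D : ℤ_[p][X]) (hD : ¬ C (p : ℤ_[p]) ∣ D) :
    ∃ (v : ℤ_[p]) (W V : ℤ_[p][X]), IsUnit v ∧ W.Monic ∧ D = C v * (W * (1 - C (p : ℤ_[p]) * V)) := by
  set e := D.natDegree with he
  set g := reflect e D with hg
  have hge : g.natDegree ≤ e := by
    rw [natDegree_le_iff_coeff_eq_zero]
    intro i hi
    rw [hg, coeff_reflect, revAt_eq_self_of_lt hi]
    exact coeff_eq_zero_of_natDegree_lt hi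
  have hmem : ∀ x : ℤ_[p], x ∈ IsLocalRing.maximalIdeal ℤ_[p] ↔ (p : ℤ_[p]) ∣ x := by
    intro x
    rw [PadicInt.maximalIdeal_eq_span_p, Ideal.mem_span_singleton]
  have hne : (g : PowerSeries ℤ_[p]).map (IsLocalRing.residue ℤ_[p]) ≠ 0 := by
    intro h0
    apply hD
    rw [C_dvd_iff_dvd_coeff]
    intro i
    have h1 := congrArg (PowerSeries.coeff (revAt e i)) h0
    rw [PowerSeries.coeff_map, map_zero, IsLocalRing.residue_eq_zero_iff, hmem, Polynomial.coeff_coe,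
      hg, coeff_reflect, revAt_invol] at h1
    exact h1
  obtain ⟨f, h, H⟩ := PowerSeries.exists_isWeierstrassFactorization hne
  have hf := H.isDistinguishedAt
  have hfm := hf.monic
  have hmt : IsLocalRing.maximalIdeal ℤ_[p] ≠ ⊤ := Ideal.IsPrime.ne_top'
  have hord := congrArg ENat.toNat (hf.coe_natDegree_eq_order_map (f : PowerSeries ℤ_[p]) 1
    (by rwa [PowerSeries.constantCoeff_one, ← Ideal.ne_top_iff_one]) (by simp))
  have hkey := (hf.isWeierstrassDivisorAt hmt).eq_of_mul_add_eq_mul_add (q := h) (r := 0)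
    (q' := ((g /ₘ f : ℤ_[p][X]) : PowerSeries ℤ_[p])) (r' := g %ₘ f)
    (by simp) (by
      rw [← hord, ENat.toNat_natCast, ← degree_eq_natDegree hfm.ne_zero]
      exact degree_modByMonic_lt _ hfm) (by
      rw [← H.eq_mul, ← Polynomial.coe_mul, Polynomial.coe_zero, add_zero, ← Polynomial.coe_add,
        add_comm, modByMonic_add_div])
  obtain ⟨hq, hr⟩ := hkey
  set q := g /ₘ f with hqdef
  have hgf : g = f * q := by
    have := modByMonic_add_div g f
    rw [← hr, zero_add] at this
    exact this.symm
  have hq0 : IsUnit (q.coeff 0) := by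
    have := H.isUnit
    rw [PowerSeries.isUnit_iff_constantCoeff, hq, Polynomial.constantCoeff_coe] at this
    exact this
  have hqne : q ≠ 0 := by
    rintro h; rw [h] at hq0; simp at hq0
  have hdeg : f.natDegree + q.natDegree ≤ e := by
    rw [← natDegree_mul hfm.ne_zero hqne, ← hgf]; exact hge
  set W0 := reflect (e - f.natDegree) q with hW0
  set U := reflect f.natDegree f with hU
  have hDUW : D = U * W0 := by
    rw [hU, hW0, ← reflect_mul _ _ le_rfl (by omega), ← hgf, hg,
      show f.natDegree + (e - f.natDegree) = e by omega]
    simp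
  obtain ⟨w, hw⟩ := hq0
  have hV : C (p : ℤ_[p]) ∣ 1 - U := by
    rw [C_dvd_iff_dvd_coeff]
    intro i
    rw [coeff_sub, hU, coeff_reflect]
    rcases Nat.eq_zero_or_pos i with rfl | hi
    · simp [revAt_le, coeff_natDegree, hfm]
    · rw [coeff_one, if_neg (by omega), zero_sub, dvd_neg]
      rcases le_or_gt i f.natDegree with h1 | h1
      · rw [revAt_le h1, ← hmem]
        exact hf.mem (by omega)
      · rw [revAt_eq_self_of_lt h1, coeff_eq_zero_of_natDegree_lt h1]
        exact dvd_zero _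
  obtain ⟨V, hV⟩ := hV
  refine ⟨w, C ((w⁻¹ : ℤ_[p]ˣ) : ℤ_[p]) * W0, V, w.isUnit, ?_, ?_⟩
  · refine monic_of_natDegree_le_of_coeff_eq_one (e - f.natDegree) ?_ ?_
    · refine (natDegree_C_mul_le _ _).trans ?_
      rw [natDegree_le_iff_coeff_eq_zero]
      intro i hi
      rw [hW0, coeff_reflect, revAt_eq_self_of_lt hi]
      exact coeff_eq_zero_of_natDegree_lt (by omega)
    · rw [coeff_C_mul, hW0, coeff_reflect, revAt_le le_rfl, Nat.sub_self, ← hw]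
      simp
  · rw [← hV, hDUW, ← mul_assoc, ← mul_assoc, ← C_mul]
    simp [mul_comm]

theorem aux_denom {ι J : Type} [Fintype ι] [DecidableEq ι] [Fintype J]
    (M : Matrix ι J ℤ) (B : ℕ) (hB1 : 1 ≤ B) (hB : ∀ i j, |M i j| ≤ (B : ℤ))
    (y : ι → ℤ) (z : J → ℚ) (hz : (M.map (Int.castRingHom ℚ)).mulVec z = fun i => (y i : ℚ)) :
    ∃ a : ℤ, a ≠ 0 ∧ |a| ≤ ((Fintype.card ι).factorial * B ^ Fintype.card ι : ℕ) ∧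
      ∃ z' : J → ℤ, M.mulVec z' = a • y := by
  classical
  let vZ : J ⊕ ι → ι → ℤ := Sum.elim (fun j i => M i j) (fun k => Pi.single k 1)
  let v : J ⊕ ι → ι → ℚ := fun c i => (vZ c i : ℚ)
  obtain ⟨s, hs1, -, hs2, hs3⟩ := exists_linearIndepOn_extension (K := ℚ) (v := v)
    (linearIndepOn_empty ℚ v) (Set.empty_subset (Set.range Sum.inl))
  obtain ⟨b, -, hsb, hb2, hb3⟩ := exists_linearIndepOn_extension (K := ℚ) (v := v)
    hs3 (Set.subset_univ s)
  have htop : ⊤ ≤ Submodule.span ℚ (Set.range fun c : b => v c) := by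
    rw [← (Pi.basisFun ℚ ι).span_eq, Submodule.span_le]
    rintro _ ⟨k, rfl⟩
    have h1 : Pi.basisFun ℚ ι k = v (Sum.inr k) := by
      ext i
      simp only [Pi.basisFun_apply, v, vZ, Sum.elim_inr, Pi.single_apply]
      split_ifs <;> simp
    have h2 := hb2 ⟨Sum.inr k, Set.mem_univ _, rfl⟩
    rw [h1]
    rwa [Set.image_eq_range] at h2
  let B0 : Module.Basis b ℚ (ι → ℚ) := Module.Basis.mk hb3 htop
  let e : b ≃ ι := B0.indexEquiv (Pi.basisFun ℚ ι)
  let B1 := B0.reindex e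
  have hB1e : ∀ k, B1 k = v (e.symm k) := by
    intro k
    rw [Module.Basis.reindex_apply]
    exact Module.Basis.mk_apply hb3 htop _
  let P : Matrix ι ι ℤ := fun i k => vZ (e.symm k) i
  have hPdet : P.det ≠ 0 := by
    intro h0
    have h1 : (P.map (Int.castRingHom ℚ)).det = 0 := by
      rw [← RingHom.mapMatrix_apply, ← RingHom.map_det, h0, map_zero]
    have h2 : LinearIndependent ℚ (P.map (Int.castRingHom ℚ)).col := by
      have : (P.map (Int.castRingHom ℚ)).col = B1 := by
        ext k i
        rw [hB1e]; rfl
      rw [this]; exact B1.linearIndependent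
    rw [Matrix.linearIndependent_cols_iff_isUnit, Matrix.isUnit_iff_isUnit_det, h1] at h2
    simp at h2
  let x : ι → ℤ := P.adjugate.mulVec y
  have hPx : P.mulVec x = P.det • y := by
    simp only [x]
    rw [Matrix.mulVec_mulVec, Matrix.mul_adjugate, Matrix.smul_mulVec, Matrix.one_mulVec]
  have hyspan : (fun i => ((P.det • y) i : ℚ)) ∈ Submodule.span ℚ (v '' s) := by
    have h1 : (fun i => ((P.det • y) i : ℚ)) = (P.det : ℚ) • ∑ j, z j • v (Sum.inl j) := by
      ext i
      have := congrFun hz i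
      simp only [Matrix.mulVec, dotProduct, Matrix.map_apply] at this
      simp only [Pi.smul_apply, smul_eq_mul, Int.cast_mul, Finset.sum_apply, ← this]
      congr 1
      refine Finset.sum_congr rfl fun j _ => ?_
      simp [v, vZ, mul_comm]
    rw [h1]
    refine Submodule.smul_mem _ _ (Submodule.sum_mem _ fun j _ => Submodule.smul_mem _ _ ?_)
    exact hs2 ⟨_, ⟨j, rfl⟩, rfl⟩
  have hxB : (fun i => ((P.det • y) i : ℚ)) = ∑ k, (x k : ℚ) • B1 k := by
    ext i
    rw [← hPx]
    simp only [Matrix.mulVec, dotProduct, Int.cast_sum, Int.cast_mul, Finset.sum_apply,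
      Pi.smul_apply, smul_eq_mul]
    refine Finset.sum_congr rfl fun k _ => ?_
    rw [hB1e, mul_comm]
  have hx0 : ∀ k, ((e.symm k : b) : J ⊕ ι) ∉ s → x k = 0 := by
    intro k hk
    have himg : v '' s = B1 '' {k | ((e.symm k : b) : J ⊕ ι) ∈ s} := by
      ext w
      constructor
      · rintro ⟨c, hc, rfl⟩
        exact ⟨e ⟨c, hsb hc⟩, by simpa using hc, by rw [hB1e]; simp⟩
      · rintro ⟨k, hk, rfl⟩
        exact ⟨_, hk, (hB1e k).symm⟩
    rw [himg, Module.Basis.mem_span_image] at hyspan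
    by_contra hne
    apply hk
    apply hyspan
    rw [Finset.mem_coe, Finsupp.mem_support_iff, hxB, Module.Basis.repr_sum_self]
    exact_mod_cast hne
  refine ⟨P.det, hPdet, ?_, fun j => ∑ k, if ((e.symm k : b) : J ⊕ ι) = Sum.inl j then x k else 0, ?_⟩
  · have := Matrix.det_le (A := P) (abv := AbsoluteValue.abs) (x := (B : ℤ)) (by
      intro i k
      simp only [P, AbsoluteValue.abs_apply]
      rcases ((e.symm k : b) : J ⊕ ι) with j | l
      · exact hB i j
      · simp only [vZ, Sum.elim_inr, Pi.single_apply]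
        split_ifs
        · simpa using hB1
        · simp)
    simpa using this
  · rw [← hPx]
    ext i
    simp only [Matrix.mulVec, dotProduct, Finset.mul_sum]
    rw [Finset.sum_comm]
    refine Finset.sum_congr rfl fun k _ => ?_
    by_cases hk : ((e.symm k : b) : J ⊕ ι) ∈ s
    · obtain ⟨j, hj⟩ := hs1 hk
      simp only [← hj, P]
      simp [vZ]
    · simp [hx0 k hk]

theorem aux_local_global {ι J : Type} [Fintype ι] [Fintype J]
    (M : Matrix ι J ℤ) (y : ι → ℤ)
    (H : ∀ (p : ℕ) [Fact p.Prime], ∃ z : J → ℤ_[p],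
      (M.map (Int.castRingHom ℤ_[p])).mulVec z = fun i => (y i : ℤ_[p])) :
    ∃ z : J → ℤ, M.mulVec z = y := by
  classical
  let S : Submodule ℤ (ι → ℤ) := LinearMap.range M.mulVecLin
  let x : (ι → ℤ) ⧸ S := Submodule.Quotient.mk y
  suffices hx : x = 0 by
    rw [Submodule.Quotient.mk_eq_zero] at hx
    obtain ⟨z, hz⟩ := hx
    exact ⟨z, hz⟩
  have key : ∀ (p : ℕ) [Fact p.Prime], ∃ r : ℤ, ((p : ℤ) * r) • x = x := by
    intro p _
    have : x ∈ (⨅ i : ℕ, (Ideal.span {(p : ℤ)}) ^ i • ⊤ : Submodule ℤ ((ι → ℤ) ⧸ S)) := by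
      rw [Submodule.mem_iInf]
      intro K
      obtain ⟨z, hz⟩ := H p
      have hdv : ∀ i, ((p : ℤ) ^ K) ∣ (y i - M.mulVec (fun j => ((z j).appr K : ℤ)) i) := by
        intro i
        rw [← PadicInt.pow_p_dvd_int_iff]
        have h1 : ((y i - M.mulVec (fun j => ((z j).appr K : ℤ)) i : ℤ) : ℤ_[p])
            = ∑ j, (M i j : ℤ_[p]) * (z j - ((z j).appr K : ℕ)) := by
          have := congrFun hz i
          simp only [Matrix.mulVec, dotProduct, Matrix.map_apply] at this
          simp only [Int.cast_sub, ← this, Matrix.mulVec, dotProduct, mul_sub,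
            Finset.sum_sub_distrib]
          simp
        rw [h1]
        refine Finset.dvd_sum fun j _ => Dvd.dvd.mul_left ?_ _
        have := PadicInt.appr_spec K (z j)
        rwa [Ideal.mem_span_singleton] at this
      choose w hw using hdv
      have hxw : x = ((p : ℤ) ^ K) • (Submodule.Quotient.mk w : (ι → ℤ) ⧸ S) := by
        rw [← Submodule.Quotient.mk_smul]
        rw [Submodule.Quotient.eq]
        refine ⟨fun j => ((z j).appr K : ℤ), ?_⟩
        ext i
        have := hw i
        simp only [Matrix.mulVecLin_apply, Pi.sub_apply, Pi.smul_apply, smul_eq_mul]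
        linarith
      rw [hxw]
      exact Submodule.smul_mem_smul (Ideal.pow_mem_pow (Ideal.mem_span_singleton_self _) _)
        Submodule.mem_top
    rw [Ideal.mem_iInf_smul_pow_eq_bot_iff] at this
    obtain ⟨⟨r, hr⟩, hrx⟩ := this
    obtain ⟨r', rfl⟩ := Ideal.mem_span_singleton.1 hr
    exact ⟨r', hrx⟩
  let I : Ideal ℤ := Ideal.torsionOf ℤ _ x
  obtain ⟨a, ha⟩ := (IsPrincipalIdealRing.principal I).principal
  have haI : ∀ c : ℤ, c • x = 0 ↔ a ∣ c := by
    intro c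
    rw [← Ideal.mem_torsionOf_iff, ← Ideal.mem_span_singleton]
    change c ∈ I ↔ _
    rw [ha]
  by_cases h1 : a.natAbs = 1
  · have : a ∣ 1 := Int.natAbs_dvd_natAbs.1 (by simp [h1])
    have := (haI 1).2 this
    simpa using this
  · obtain ⟨p, hp, hpa⟩ := Nat.exists_prime_and_dvd h1
    have : Fact p.Prime := ⟨hp⟩
    obtain ⟨r, hr⟩ := key p
    have h2 : a ∣ (1 - p * r) := by
      rw [← haI, sub_smul, one_smul, hr, sub_self]
    have h3 : (p : ℤ) ∣ 1 := by
      have h4 : (p : ℤ) ∣ 1 - p * r := (Int.natCast_dvd.2 hpa).trans h2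
      have := dvd_add h4 (dvd_mul_right (p : ℤ) r)
      simpa using this
    have := Int.natCast_dvd.1 h3
    simp at this
    exact absurd this hp.one_lt.ne'

/-- The convolution matrix of `F` for unknowns of degree at most `N`. -/
noncomputable def auxConv {R : Type*} [CommRing R] {n m : ℕ} (F : Matrix (Fin n) (Fin m) R[X])
    (N d : ℕ) : Matrix (Fin n × Fin (N + d + 1)) (Fin m × Fin (N + 1)) R :=
  fun a c => (F a.1 c.1 * X ^ (c.2 : ℕ)).coeff a.2

theorem auxConv_mulVec {R : Type*} [CommRing R] {n m : ℕ} (F : Matrix (Fin n) (Fin m) R[X])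
    (N d : ℕ) (z : Fin m × Fin (N + 1) → R) (a : Fin n × Fin (N + d + 1)) :
    (auxConv F N d).mulVec z a =
      ((F.mulVec fun j => ∑ s : Fin (N + 1), C (z (j, s)) * X ^ (s : ℕ)) a.1).coeff a.2 := by
  simp only [Matrix.mulVec, dotProduct, auxConv, Fintype.sum_prod_type, finsetSum_coeff,
    Finset.mul_sum]
  refine Finset.sum_congr rfl fun j _ => Finset.sum_congr rfl fun s _ => ?_
  rw [mul_left_comm, coeff_C_mul, mul_comm]

theorem aux_conv_iff {R : Type*} [CommRing R] {n m : ℕ} (F : Matrix (Fin n) (Fin m) R[X])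
    (N d : ℕ) (hd : ∀ i j, (F i j).natDegree ≤ d) (b : Fin n → R[X])
    (hb : ∀ i, (b i).natDegree ≤ N + d) :
    (∃ u : Fin m → R[X], F.mulVec u = b ∧ ∀ j, (u j).natDegree ≤ N) ↔
      ∃ z, (auxConv F N d).mulVec z = fun a => (b a.1).coeff a.2 := by
  constructor
  · rintro ⟨u, rfl, hu⟩
    refine ⟨fun c => (u c.1).coeff c.2, ?_⟩
    ext a
    rw [auxConv_mulVec]
    congr 3
    ext1 j
    rw [Fin.sum_univ_eq_sum_range (fun s => C ((u j).coeff s) * X ^ s) (N + 1)]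
    exact ((u j).as_sum_range_C_mul_X_pow' (Nat.lt_succ_of_le (hu j))).symm
  · rintro ⟨z, hz⟩
    have hdeg : ∀ j, (∑ s : Fin (N + 1), C (z (j, s)) * X ^ (s : ℕ)).natDegree ≤ N := fun j =>
      natDegree_sum_le_of_forall_le _ _ fun s _ =>
        (natDegree_C_mul_X_pow_le _ _).trans (Nat.lt_succ_iff.1 s.2)
    refine ⟨fun j => ∑ s : Fin (N + 1), C (z (j, s)) * X ^ (s : ℕ), ?_, hdeg⟩
    ext i r
    by_cases hr : r < N + d + 1
    · have := congrFun hz (i, ⟨r, hr⟩)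
      rw [auxConv_mulVec] at this
      exact this
    · rw [coeff_eq_zero_of_natDegree_lt (p := b i) (by have := hb i; omega)]
      apply coeff_eq_zero_of_natDegree_lt
      have : ((F.mulVec fun j => ∑ s : Fin (N + 1), C (z (j, s)) * X ^ (s : ℕ)) i).natDegree
          ≤ N + d := by
        simp only [Matrix.mulVec, dotProduct]
        refine natDegree_sum_le_of_forall_le _ _ fun j _ => ?_
        refine natDegree_mul_le.trans ?_
        have := hd i j
        have := hdeg j
        omega
      omega

theorem auxConv_map {R S : Type*} [CommRing R] [CommRing S] (φ : R →+* S) {n m : ℕ}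
    (F : Matrix (Fin n) (Fin m) R[X]) (N d : ℕ) :
    auxConv (F.map (Polynomial.map φ)) N d = (auxConv F N d).map φ := by
  ext a c
  simp only [auxConv, Matrix.map_apply]
  rw [← coeff_map, Polynomial.map_mul, Polynomial.map_pow, map_X]

theorem aux_minor {K : Type*} [Field K] {n m : ℕ} (M : Matrix (Fin n) (Fin m) K)
    (h : M.rank = n) : ∃ σ : Fin n → Fin m, (M.submatrix id σ).det ≠ 0 := by
  classical
  obtain ⟨κ, a, ha, hspan, hli⟩ := exists_linearIndependent' K M.col
  have : Finite κ := Finite.of_injective a ha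
  have : Fintype κ := Fintype.ofFinite κ
  have hcard : Fintype.card κ = n := by
    rw [← finrank_span_eq_card hli, hspan, ← Matrix.rank_eq_finrank_span_cols, h]
  let e : Fin n ≃ κ := (Fintype.equivFinOfCardEq hcard).symm
  refine ⟨a ∘ e, fun h0 => ?_⟩
  have h2 : LinearIndependent K (M.submatrix id (a ∘ e)).col :=
    hli.comp e e.injective
  rw [Matrix.linearIndependent_cols_iff_isUnit, Matrix.isUnit_iff_isUnit_det, h0] at h2
  simp at h2

theorem aux_rat {K : Type*} [Field K] {n m : ℕ}
    (F : Matrix (Fin n) (Fin m) K[X]) (d : ℕ) (hd : ∀ i j, (F i j).natDegree ≤ d)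
    (σ : Fin n → Fin m) (hσ : (F.submatrix id σ).det ≠ 0)
    (u : Fin m → K[X]) (b : Fin n → K[X]) (hb : F.mulVec u = b)
    (hbd : ∀ i, (b i).natDegree ≤ n * d) :
    ∃ u' : Fin m → K[X], F.mulVec u' = b ∧ ∀ j, (u' j).natDegree ≤ 2 * (n * d) := by
  set D := (F.submatrix id σ).det with hD
  have hlc : D.leadingCoeff ≠ 0 := leadingCoeff_ne_zero.2 hσ
  obtain ⟨u', h1, h2⟩ := aux_solve F d hd σ (C D.leadingCoeff) (D * C D.leadingCoeff⁻¹) 1 1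
    (by
      rw [mul_one, mul_left_comm, ← C_mul, mul_inv_cancel₀ hlc, C_1, mul_one])
    (by simpa using hσ) (monic_mul_leadingCoeff_inv hσ) one_ne_zero
    (fun τ => (isUnit_C.2 (isUnit_iff_ne_zero.2 hlc)).dvd) u b hb hbd 0 (by simp)
  refine ⟨u', by simpa using h1, fun j => by simpa using h2 j⟩

theorem aux_padic {p : ℕ} [hp : Fact p.Prime] {n m : ℕ}
    (F : Matrix (Fin n) (Fin m) ℤ_[p][X]) (d : ℕ) (hd : ∀ i j, (F i j).natDegree ≤ d)
    (σ₀ : Fin n → Fin m) (hσ₀ : (F.submatrix id σ₀).det ≠ 0)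
    (u : Fin m → ℤ_[p][X]) (b : Fin n → ℤ_[p][X]) (hb : F.mulVec u = b)
    (hbd : ∀ i, (b i).natDegree ≤ n * d) (k : ℕ) (a' : ℤ_[p]ˣ) (v : Fin m → ℤ_[p][X])
    (hv : F.mulVec v = (C ((a' : ℤ_[p]) * (p : ℤ_[p]) ^ k)) • b)
    (hvd : ∀ j, (v j).natDegree ≤ 2 * (n * d)) :
    ∃ u' : Fin m → ℤ_[p][X], F.mulVec u' = b ∧
      ∀ j, (u' j).natDegree ≤ k * (n * d) + 2 * (n * d) := by
  classical
  have hp0 : (p : ℤ_[p]) ≠ 0 := by exact_mod_cast hp.1.ne_zero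
  have hCp : C (p : ℤ_[p]) ≠ 0 := by simpa using hp0
  have hCpu : ¬ IsUnit (C (p : ℤ_[p])) := by
    rw [isUnit_C]; exact PadicInt.p_nonunit
  have hex : ∃ k : ℕ, ∃ τ : Fin n → Fin m, ¬ C (p : ℤ_[p]) ^ k ∣ (F.submatrix id τ).det := by
    obtain ⟨k, hk⟩ := FiniteMultiplicity.of_not_isUnit hCpu hσ₀
    exact ⟨k + 1, σ₀, hk⟩
  obtain ⟨σ, hσ⟩ := Nat.find_spec hex
  have hmin := fun k (hk : k < Nat.find hex) => Nat.find_min hex hk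
  have hne : Nat.find hex ≠ 0 := by
    intro h0; rw [h0] at hσ; simp at hσ
  obtain ⟨μ, hμ⟩ := Nat.exists_eq_succ_of_ne_zero hne
  rw [hμ] at hσ hmin
  have hall : ∀ τ : Fin n → Fin m, C (p : ℤ_[p]) ^ μ ∣ (F.submatrix id τ).det := by
    intro τ
    by_contra hτ
    exact hmin μ (Nat.lt_succ_self _) ⟨τ, hτ⟩
  obtain ⟨D1, hD1⟩ := hall σ
  have hnD1 : ¬ C (p : ℤ_[p]) ∣ D1 := by
    intro h
    apply hσ
    rw [hD1, Nat.succ_eq_add_one, pow_succ]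
    exact mul_dvd_mul_left _ h
  obtain ⟨w, W, V, hw, hW, hfac⟩ := aux_factor D1 hnD1
  set U := 1 - C (p : ℤ_[p]) * V with hUdef
  have hD10 : D1 ≠ 0 := by rintro rfl; exact hnD1 (dvd_zero _)
  have hU0 : U ≠ 0 := by
    intro h; rw [h] at hfac; simp at hfac; exact hD10 hfac
  have hw0 : C w ≠ 0 := by simpa using hw.ne_zero
  have hσdet0 : (F.submatrix id σ).det ≠ 0 := by
    rw [hD1]; exact mul_ne_zero (pow_ne_zero _ hCp) hD10
  have hVd : V.natDegree ≤ n * d := by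
    have h1 : V.natDegree ≤ U.natDegree := by
      have : C (p : ℤ_[p]) * V = 1 - U := by rw [hUdef]; ring
      rw [← natDegree_C_mul hp0, this]
      refine (natDegree_sub_le _ _).trans ?_
      simp
    have h2 : (F.submatrix id σ).det.natDegree ≤ n * d := by
      refine (aux_natDegree_det_le _ (fun _ => d) (fun i j => hd _ _)).trans ?_
      simp
    rw [hD1, natDegree_mul (pow_ne_zero _ hCp) hD10, hfac,
      natDegree_mul hw0 (mul_ne_zero hW.ne_zero hU0), natDegree_mul hW.ne_zero hU0] at h2
    omega
  -- the approximate idempotent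
  have hα : U * ∑ i ∈ Finset.range k, (C (p : ℤ_[p]) * V) ^ i = 1 - (C (p : ℤ_[p]) * V) ^ k := by
    rw [hUdef]; exact mul_neg_geom_sum _ _
  obtain ⟨u', h1, h2⟩ := aux_solve F d hd σ (C (p : ℤ_[p]) ^ μ * C w) W U
    (∑ i ∈ Finset.range k, (C (p : ℤ_[p]) * V) ^ i)
    (by rw [hD1, hfac]; ring) (mul_ne_zero (pow_ne_zero _ hCp) hw0) hW hU0
    (fun τ => ((isUnit_C.2 hw).mul_right_dvd).2 (hall τ)) u b hb hbd (k * (n * d))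
    (by
      rw [hα]
      refine (natDegree_sub_le _ _).trans ?_
      rw [natDegree_one, Nat.zero_max]
      refine natDegree_pow_le.trans ?_
      refine Nat.mul_le_mul_left _ ?_
      exact (natDegree_C_mul_le _ _).trans hVd)
  refine ⟨u' + (V ^ k * C ((a'⁻¹ : ℤ_[p]ˣ) : ℤ_[p])) • v, ?_, fun j => ?_⟩
  · rw [Matrix.mulVec_add, Matrix.mulVec_smul, h1, hv, hα, smul_smul, ← add_smul]
    have : (1 - (C (p : ℤ_[p]) * V) ^ k + V ^ k * C ((a'⁻¹ : ℤ_[p]ˣ) : ℤ_[p]) *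
        C ((a' : ℤ_[p]) * (p : ℤ_[p]) ^ k)) = 1 := by
      rw [mul_assoc, ← C_mul, ← mul_assoc, Units.inv_mul, one_mul, C_pow, mul_pow]
      ring
    rw [this, one_smul]
  · rw [Pi.add_apply]
    refine (natDegree_add_le _ _).trans (max_le (h2 j) ?_)
    rw [Pi.smul_apply, smul_eq_mul]
    refine natDegree_mul_le.trans (Nat.add_le_add ?_ (hvd j))
    refine (natDegree_mul_C_le _ _).trans (natDegree_pow_le.trans (Nat.mul_le_mul_left _ hVd))

theorem aux_coeff_le (f : ℤ[X]) (h : ℝ) (hh : polyHeight f ≤ h) (r : ℕ) :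
    |f.coeff r| ≤ (⌊Real.exp h⌋₊ : ℤ) := by
  by_cases hr : f.coeff r = 0
  · rw [hr]; simp
  have h1 : (f.coeff r).natAbs ≤
      (Finset.range (f.natDegree + 1)).sup fun k => (f.coeff k).natAbs :=
    Finset.le_sup (f := fun k => (f.coeff k).natAbs)
      (Finset.mem_range.2 (Nat.lt_succ_of_le (le_natDegree_of_ne_zero hr)))
  unfold polyHeight at hh
  set s := (Finset.range (f.natDegree + 1)).sup fun k => (f.coeff k).natAbs with hs
  have hpos : 0 < s := lt_of_lt_of_le (Int.natAbs_pos.2 hr) h1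
  have h2 : (s : ℝ) ≤ Real.exp h := by
    rwa [← Real.log_le_iff_le_exp (by exact_mod_cast hpos)]
  have h3 : s ≤ ⌊Real.exp h⌋₊ := Nat.le_floor h2
  rw [Int.abs_eq_natAbs]
  exact_mod_cast h1.trans h3

theorem aux_polyHeight_nonneg (f : ℤ[X]) : 0 ≤ polyHeight f := Real.log_natCast_nonneg _

theorem aux_numeric (n d L R B : ℕ) (hn : 1 ≤ n) (hd : 1 ≤ d) (h : ℝ) (h0 : 0 ≤ h)
    (hR : R ≤ 4 * (n ^ 2 * d)) (hR1 : 1 ≤ R) (hB : (B : ℝ) ≤ Real.exp h)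
    (hL : 2 ^ L ≤ R.factorial * B ^ R) :
    (((L + 2) * (n * d) : ℕ) : ℝ) ≤ 73 * (n : ℝ) ^ 8 * (d : ℝ) ^ 5 *
          (h + 1 + Real.log ((n : ℝ) ^ 2 * (d : ℝ))) := by
  have hn' : (1 : ℝ) ≤ n := by exact_mod_cast hn
  have hd' : (1 : ℝ) ≤ d := by exact_mod_cast hd
  have hQ : (1 : ℝ) ≤ (n : ℝ) ^ 2 * d := by
    have := one_le_pow₀ hn' (n := 2); nlinarith
  set l := Real.log ((n : ℝ) ^ 2 * (d : ℝ)) with hl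
  have hl0 : 0 ≤ l := Real.log_nonneg hQ
  have hRR : (R : ℝ) ≤ 4 * ((n : ℝ) ^ 2 * d) := by exact_mod_cast hR
  have hRpos : (0 : ℝ) < R := by exact_mod_cast hR1
  have hlogR : Real.log R ≤ 2 * Real.log 2 + l := by
    have h1 := Real.log_le_log hRpos hRR
    rw [Real.log_mul (by norm_num) (by linarith), show (4 : ℝ) = 2 ^ 2 by norm_num,
      Real.log_pow] at h1
    rw [← hl] at h1
    norm_num at h1
    exact h1
  have hlog2a := Real.log_two_gt_d9
  have hlog2b := Real.log_two_lt_d9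
  have h1 : (2 : ℝ) ^ L ≤ (R : ℝ) ^ R * Real.exp h ^ R := by
    have h2 : (2 : ℝ) ^ L ≤ (R.factorial : ℝ) * (B : ℝ) ^ R := by exact_mod_cast hL
    refine h2.trans ?_
    have h3 : (R.factorial : ℝ) ≤ (R : ℝ) ^ R := by exact_mod_cast Nat.factorial_le_pow R
    gcongr
  have h2 : (L : ℝ) * Real.log 2 ≤ R * (Real.log R + h) := by
    have h3 := Real.log_le_log (by positivity) h1
    rw [Real.log_pow, Real.log_mul (by positivity) (by positivity), Real.log_pow, Real.log_pow,
      Real.log_exp] at h3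
    linarith
  set H := h + 1 + l with hH
  have hH1 : 1 ≤ H := by linarith
  have h3 : (R : ℝ) * (Real.log R + h) ≤ 4 * ((n : ℝ) ^ 2 * d) * (2 * H) := by
    have hlR : 0 ≤ Real.log R := Real.log_natCast_nonneg R
    apply mul_le_mul hRR _ (by linarith) (by positivity)
    linarith
  have hQH : 1 ≤ (n : ℝ) ^ 2 * d * H := by nlinarith
  have h4 : (L : ℝ) ≤ 12 * ((n : ℝ) ^ 2 * d * H) := by
    have hL0 : (0 : ℝ) ≤ L := Nat.cast_nonneg L
    nlinarith
  have h5 : (L : ℝ) + 2 ≤ 14 * ((n : ℝ) ^ 2 * d * H) := by linarith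
  push_cast
  calc ((L : ℝ) + 2) * (n * d) ≤ 14 * ((n : ℝ) ^ 2 * d * H) * (n * d) := by gcongr
    _ = 14 * (n : ℝ) ^ 3 * (d : ℝ) ^ 2 * H := by ring
    _ ≤ 73 * (n : ℝ) ^ 8 * (d : ℝ) ^ 5 * H := by
      gcongr <;> first | assumption | norm_num

/-- Let F ∈ ℤ[x]^{n×m} have full row rank n over ℚ(x), with d = deg(F) ≥ 1
and h = height(F), and let L ⊆ ℤ[x]^n be the ℤ[x]-module generated by the columns of F.
Then for every b ∈ L with deg(b) ≤ n·d and height(b) ≤ 6n³d²(h + 1 + log(n²d)) there is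
u ∈ ℤ[x]^m with F·u = b and deg(u) ≤ 73·n⁸·d⁵·(h + 1 + log(n²d)). -/
theorem stmt18 {n m : ℕ} (F : Matrix (Fin n) (Fin m) (Polynomial ℤ))
    (hrank : (F.map fun q =>
      algebraMap (Polynomial ℚ) (RatFunc ℚ) (q.map (Int.castRingHom ℚ))).rank = n)
    (d : ℕ) (hd1 : 1 ≤ d) (hd : ∀ i j, (F i j).natDegree ≤ d)
    (h : ℝ) (hh : ∀ i j, polyHeight (F i j) ≤ h) :
    ∀ b : Fin n → Polynomial ℤ,
      b ∈ Submodule.span (Polynomial ℤ)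
        (Set.range fun j : Fin m => fun i : Fin n => F i j) →
      (∀ i, (b i).natDegree ≤ n * d) →
      (∀ i, polyHeight (b i) ≤ 6 * (n : ℝ) ^ 3 * (d : ℝ) ^ 2 *
        (h + 1 + Real.log ((n : ℝ) ^ 2 * (d : ℝ)))) →
      ∃ u : Fin m → Polynomial ℤ, F.mulVec u = b ∧
        ∀ j, ((u j).natDegree : ℝ) ≤ 73 * (n : ℝ) ^ 8 * (d : ℝ) ^ 5 *
          (h + 1 + Real.log ((n : ℝ) ^ 2 * (d : ℝ))) := by
  intro b hbL hbd _
  classical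
  rcases Nat.eq_zero_or_pos n with rfl | hn
  · exact ⟨0, Subsingleton.elim _ _, fun j => by simp⟩
  -- a solution of unbounded degree
  obtain ⟨u, hu⟩ : ∃ u : Fin m → ℤ[X], F.mulVec u = b := by
    rw [Submodule.mem_span_range_iff_exists_fun] at hbL
    obtain ⟨c, hc⟩ := hbL
    refine ⟨c, ?_⟩
    rw [← hc]
    ext1 i
    simp [Matrix.mulVec, dotProduct, mul_comm]
  -- a nonzero minor
  obtain ⟨σ, hσ⟩ := aux_minor _ hrank
  have hσ0 : (F.submatrix id σ).det ≠ 0 := by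
    intro h0
    apply hσ
    let φ : ℤ[X] →+* RatFunc ℚ :=
      (algebraMap ℚ[X] (RatFunc ℚ)).comp (mapRingHom (Int.castRingHom ℚ))
    have h1 : (F.map fun q =>
      algebraMap ℚ[X] (RatFunc ℚ) (q.map (Int.castRingHom ℚ))).submatrix id σ
        = φ.mapMatrix (F.submatrix id σ) := by
      ext i j
      simp [φ]
    rw [h1, ← RingHom.map_det, h0, map_zero]
  have h0 : 0 ≤ h := (aux_polyHeight_nonneg (F ⟨0, hn⟩ (σ ⟨0, hn⟩))).trans (hh _ _)
  -- base change
  have hmapdet : ∀ {S : Type} [CommRing S] (φ : ℤ →+* S), Function.Injective φ →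
      ((F.map (Polynomial.map φ)).submatrix id σ).det ≠ 0 := by
    intro S _ φ hφ h1
    apply hσ0
    apply Polynomial.map_injective φ hφ
    have h2 : (F.map (Polynomial.map φ)).submatrix id σ
        = (mapRingHom φ).mapMatrix (F.submatrix id σ) := by
      ext i j : 2
      simp
    rw [h2, ← RingHom.map_det] at h1
    simpa using h1
  have hmapvec : ∀ {S : Type} [CommRing S] (φ : ℤ →+* S) (w : Fin m → ℤ[X]) (c : Fin n → ℤ[X]),
      F.mulVec w = c → (F.map (Polynomial.map φ)).mulVec (fun j => (w j).map φ)
        = fun i => (c i).map φ := by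
    intro S _ φ w c hc
    subst hc
    ext1 i
    simp [Matrix.mulVec, dotProduct, Polynomial.map_sum]
  have hmapdeg : ∀ {S : Type} [CommRing S] (φ : ℤ →+* S) (i : Fin n) (j : Fin m),
      ((F.map (Polynomial.map φ)) i j).natDegree ≤ d := fun φ i j =>
    natDegree_map_le.trans (hd i j)
  -- the rational solution
  obtain ⟨uq, huq, huqd⟩ := aux_rat (F.map (Polynomial.map (Int.castRingHom ℚ))) d (hmapdeg _) σ
    (hmapdet _ (RingHom.injective_int _)) _ _ (hmapvec _ u b hu)
    (fun i => natDegree_map_le.trans (hbd i))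
  obtain ⟨zq, hzq⟩ := (aux_conv_iff (F.map (Polynomial.map (Int.castRingHom ℚ))) (2 * (n * d)) d
    (hmapdeg _) (fun i => (b i).map (Int.castRingHom ℚ))
    (fun i => natDegree_map_le.trans ((hbd i).trans (by omega)))).1 ⟨uq, huq, huqd⟩
  rw [auxConv_map] at hzq
  set B := ⌊Real.exp h⌋₊ with hBdef
  have hB1 : 1 ≤ B := Nat.le_floor (by simpa using h0)
  obtain ⟨a, ha0, haB, z', hz'⟩ := aux_denom (auxConv F (2 * (n * d)) d) B hB1 (by
      intro x c
      simp only [auxConv]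
      rw [coeff_mul_X_pow']
      split_ifs
      · exact aux_coeff_le _ h (hh _ _) _
      · simp)
    (fun x => (b x.1).coeff x.2) zq (by rw [hzq]; ext x; simp)
  obtain ⟨v, hv, hvd⟩ := (aux_conv_iff F (2 * (n * d)) d hd (C a • b) (by
      intro i
      rw [Pi.smul_apply, smul_eq_mul]
      exact (natDegree_C_mul_le _ _).trans ((hbd i).trans (by omega)))).2 ⟨z', by
        rw [hz']; ext x; simp⟩
  set L := Nat.log 2 a.natAbs with hLdef
  set N := (L + 2) * (n * d) with hN
  -- gluing
  have hglue : ∃ u' : Fin m → ℤ[X], F.mulVec u' = b ∧ ∀ j, (u' j).natDegree ≤ N := by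
    have hbN : ∀ i, (b i).natDegree ≤ N + d := by
      intro i
      refine (hbd i).trans ?_
      rw [hN]; nlinarith
    rw [aux_conv_iff F N d hd b hbN]
    apply aux_local_global
    intro p hp
    let φ := Int.castRingHom ℤ_[p]
    have haz : (a : ℤ_[p]) ≠ 0 := by exact_mod_cast ha0
    have hspec := PadicInt.unitCoeff_spec haz
    set k := (a : ℤ_[p]).valuation with hk
    have hkL : k ≤ L := by
      have h1 : (p : ℤ_[p]) ^ k ∣ ((a : ℤ) : ℤ_[p]) := ⟨_, by rw [mul_comm]; exact hspec⟩
      have h2 : (p : ℤ) ^ k ∣ a := by rwa [PadicInt.pow_p_dvd_int_iff] at h1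
      have h3 : p ^ k ≤ a.natAbs := by
        apply Nat.le_of_dvd (Int.natAbs_pos.2 ha0)
        have := Int.natAbs_dvd_natAbs.2 h2
        simpa [Int.natAbs_pow] using this
      have h4 : 2 ^ k ≤ a.natAbs := (Nat.pow_le_pow_left hp.1.two_le k).trans h3
      exact Nat.le_log_of_pow_le (by norm_num) h4
    obtain ⟨u', hu', hud'⟩ := aux_padic (F.map (Polynomial.map φ)) d (hmapdeg _) σ
      (hmapdet _ (RingHom.injective_int _)) _ _ (hmapvec φ u b hu)
      (fun i => natDegree_map_le.trans (hbd i)) k (PadicInt.unitCoeff haz)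
      (fun j => (v j).map φ) (by
        rw [hmapvec φ v _ hv, ← hspec]
        ext1 i
        simp [φ]) (fun j => natDegree_map_le.trans (hvd j))
    obtain ⟨z, hz⟩ := (aux_conv_iff (F.map (Polynomial.map φ)) N d (hmapdeg _)
      (fun i => (b i).map φ) (fun i => natDegree_map_le.trans (hbN i))).1
      ⟨u', hu', fun j => (hud' j).trans (by
        rw [hN, ← add_mul]; exact Nat.mul_le_mul_right _ (by omega))⟩
    rw [auxConv_map] at hz
    refine ⟨z, ?_⟩
    rw [hz]; ext x; simp [φ]
  obtain ⟨u', hu', hud'⟩ := hglue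
  refine ⟨u', hu', fun j => ?_⟩
  have hle : ((u' j).natDegree : ℝ) ≤ (N : ℝ) := by exact_mod_cast hud' j
  refine hle.trans ?_
  refine aux_numeric n d L (n * (2 * (n * d) + d + 1)) B hn hd1 h h0 ?_ ?_
    (Nat.floor_le (Real.exp_pos h).le) ?_
  · have : 1 ≤ n * d := Nat.mul_pos hn hd1
    have : d ≤ n * d := Nat.le_mul_of_pos_left d hn
    calc n * (2 * (n * d) + d + 1) ≤ n * (4 * (n * d)) := Nat.mul_le_mul_left _ (by omega)
      _ = _ := by ring
  · exact Nat.mul_pos hn (Nat.succ_pos _)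
  · have h1 : 2 ^ L ≤ a.natAbs := Nat.pow_log_le_self 2 (Int.natAbs_ne_zero.2 ha0)
    refine h1.trans ?_
    rw [Int.abs_eq_natAbs, Int.ofNat_le] at haB
    simpa only [Fintype.card_prod, Fintype.card_fin] using haB
end
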